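/- Let F_1, …, F_ℓ be layered 3-graphs on the same vertex set that have the same reduced graph under a common layered function f with k layers. Suppose π_⸫(F_i) = 0 for all 1 ≤ i ≤ ℓ, and suppose there is a common labeling σ of the vertex set such that for every i and every vertex v the link graph L_{F_i}(v) contains no monotone P3 under σ. Then for any set S ⊆ {1,…,k} of layers containing no linked pair, the S-union F = (⊕_{i=1}^ℓ F_i)/S satisfies π_⸫(F) = 0. -/

import Mathlib

open Finset

structure ThreeGraph (V : Type*) where
  edges : Finset (Finset V)
  card_eq : ∀ e ∈ edges, e.card = 3

variable {α β : Type*}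

/-- `H` contains a copy of `F`. -/
def HasCopy [DecidableEq β] (H : ThreeGraph β) (F : ThreeGraph α) : Prop :=
  ∃ φ : α → β, Function.Injective φ ∧ ∀ e ∈ F.edges, e.image φ ∈ H.edges

/-- The codegree of a pair of vertices. -/
def codeg [DecidableEq β] [Fintype β] (H : ThreeGraph β) (u v : β) : ℕ :=
  (Finset.univ.filter (fun w => ({u, v, w} : Finset β) ∈ H.edges)).card

/-- The codegree Turán density of a 3-graph `F`. -/
noncomputable def piCo (F : ThreeGraph α) : ℝ :=
  sSup {x : ℝ | 0 ≤ x ∧ x ≤ 1 ∧ ∀ n₀ : ℕ, ∃ n : ℕ, n₀ ≤ n ∧ ∃ H : ThreeGraph (Fin n),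
    ¬ HasCopy H F ∧ ∀ u v : Fin n, u ≠ v → x * n ≤ (codeg H u v : ℝ)}

/-- An `n`-vertex 3-graph is uniformly `(d, η)`-dense. -/
def UniformlyDense {n : ℕ} (H : ThreeGraph (Fin n)) (d η : ℝ) : Prop :=
  ∀ U : Finset (Fin n),
    d * (U.card.choose 3 : ℝ) - η * (n : ℝ) ^ 3 ≤ ((H.edges.filter (fun e => e ⊆ U)).card : ℝ)

/-- The uniform Turán density of a 3-graph `F`. -/
noncomputable def piUnif (F : ThreeGraph α) : ℝ :=
  sSup {d : ℝ | 0 ≤ d ∧ d ≤ 1 ∧ ∀ η : ℝ, 0 < η → ∀ n₀ : ℕ, ∃ n : ℕ, n₀ ≤ n ∧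
    ∃ H : ThreeGraph (Fin n), ¬ HasCopy H F ∧ UniformlyDense H d η}

/-- `f` is a layered function of the 3-graph with edge set `E`. -/
def IsLayeredFunction [DecidableEq α] (E : Finset (Finset α)) (f : α → ℕ) : Prop :=
  (∀ e ∈ E, ∃ w ∈ e, ∀ u ∈ e, u ≠ w → f u < f w) ∧
  (∀ e₁ ∈ E, ∀ e₂ ∈ E, e₁.sup f = e₂.sup f → Multiset.map f e₁.val = Multiset.map f e₂.val) ∧
  (∀ e₁ ∈ E, ∀ e₂ ∈ E, ∀ u v w u' v' w' : α,
    u ≠ v → u ≠ w → v ≠ w → u' ≠ v' → u' ≠ w' → v' ≠ w' →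
    e₁ = {u, v, w} → e₂ = {u', v', w'} →
    f u = f u' → f v = f v' → f w = f w')

/-- A 3-graph is layered if it admits a layered function. -/
def IsLayered [DecidableEq α] (F : ThreeGraph α) : Prop :=
  ∃ f : α → ℕ, IsLayeredFunction F.edges f

/-- A labeling of a finite set `A`: a bijection from `A` onto `{1, …, |A|}`. -/
def IsLabeling [DecidableEq α] (A : Finset α) (σ : α → ℕ) : Prop :=
  Set.BijOn σ ↑A ↑(Finset.Icc 1 A.card)

/-- The vertex set of the `S`-union of `ℓ` layered 3-graphs on vertex set `α`: vertices on
layers in `S` (i.e. with `f`-value in `S`) are identified, the others get `ℓ` disjoint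
copies. -/
abbrev LayerUnionVert (α : Type*) (f : α → ℕ) (S : Finset ℕ) (ℓ : ℕ) : Type _ :=
  {v : α // f v ∈ S} ⊕ ({v : α // f v ∉ S} × Fin ℓ)

/-- The canonical embedding of the `i`-th copy of `α` into the `S`-union vertex set. -/
def layerUnionMap {α : Type*} (f : α → ℕ) (S : Finset ℕ) {ℓ : ℕ} (i : Fin ℓ) (v : α) :
    LayerUnionVert α f S ℓ :=
  if h : f v ∈ S then Sum.inl ⟨v, h⟩ else Sum.inr (⟨v, h⟩, i)

lemma layerUnionMap_injective {α : Type*} (f : α → ℕ) (S : Finset ℕ) {ℓ : ℕ} (i : Fin ℓ) :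
    Function.Injective (layerUnionMap f S i) := by
  intro v w h
  unfold layerUnionMap at h
  split_ifs at h <;> simp_all

/-- The `S`-union of the 3-graphs `F 0, …, F (ℓ-1)`. -/
def layerUnion {α : Type*} [DecidableEq α] {ℓ : ℕ} (F : Fin ℓ → ThreeGraph α)
    (f : α → ℕ) (S : Finset ℕ) : ThreeGraph (LayerUnionVert α f S ℓ) where
  edges := Finset.univ.biUnion
    (fun i : Fin ℓ => (F i).edges.image (Finset.image (layerUnionMap f S i)))
  card_eq := by
    intro e he
    obtain ⟨i, -, he⟩ := Finset.mem_biUnion.mp he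
    obtain ⟨e', he', rfl⟩ := Finset.mem_image.mp he
    rw [Finset.card_image_of_injective _ (layerUnionMap_injective f S i)]
    exact (F i).card_eq e' he'

/-- Ramsey's theorem for subsequences of a finite list. -/
theorem ramsey_sublist (k : ℕ) : ∀ l n : ℕ, ∃ N : ℕ, ∀ {ι : Type} (P : List ι → Prop) (A : List ι),
    N ≤ A.length →
    (∃ B, B.Sublist A ∧ B.length = n ∧ ∀ J, J.Sublist B → J.length = k → P J) ∨
    (∃ B, B.Sublist A ∧ B.length = l ∧ ∀ J, J.Sublist B → J.length = k → ¬ P J) := by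
  induction k with
  | zero =>
    intro l n
    refine ⟨max l n, fun P A hA => ?_⟩
    by_cases h : P []
    · refine Or.inl ⟨A.take n, A.take_sublist n, by simp; omega, fun J _ hJ => ?_⟩
      rw [List.length_eq_zero_iff.mp hJ]; exact h
    · refine Or.inr ⟨A.take l, A.take_sublist l, by simp; omega, fun J _ hJ => ?_⟩
      rw [List.length_eq_zero_iff.mp hJ]; exact h
  | succ k ih =>
    intro l
    induction l with
    | zero =>
      intro n
      refine ⟨0, fun P A _ => Or.inr ⟨[], A.nil_sublist, rfl, fun J hJ hl => ?_⟩⟩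
      rw [List.sublist_nil.mp hJ] at hl; simp at hl
    | succ l ihl =>
      intro n
      induction n with
      | zero =>
        refine ⟨0, fun P A _ => Or.inl ⟨[], A.nil_sublist, rfl, fun J hJ hl => ?_⟩⟩
        rw [List.sublist_nil.mp hJ] at hl; simp at hl
      | succ n ihn =>
        obtain ⟨N₁, h₁⟩ := ihn
        obtain ⟨N₂, h₂⟩ := ihl (n + 1)
        obtain ⟨N₀, h₀⟩ := ih N₂ N₁
        refine ⟨N₀ + 1, fun P A hA => ?_⟩
        match A, hA with
        | a :: A', hA =>
          have hA' : N₀ ≤ A'.length := by simpa using hA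
          have extend : ∀ (Q : List _ → Prop) (B C : List _), C.Sublist B →
              (∀ J, J.Sublist B → J.length = k → Q (a :: J)) →
              (∀ J, J.Sublist C → J.length = k + 1 → Q J) →
              ∀ J, J.Sublist (a :: C) → J.length = k + 1 → Q J := by
            intro Q B C hCB hB hC J hJ hl
            rcases List.sublist_cons_iff.mp hJ with h | ⟨r, rfl, hr⟩
            · exact hC J h hl
            · exact hB r (hr.trans hCB) (by simpa using hl)
          rcases h₀ (fun J => P (a :: J)) A' hA' with ⟨B, hBA, hBl, hB⟩ | ⟨B, hBA, hBl, hB⟩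
          · rcases h₁ P B hBl.ge with ⟨C, hCB, hCl, hC⟩ | ⟨C, hCB, hCl, hC⟩
            · exact Or.inl ⟨a :: C, (hCB.trans hBA).cons_cons a, by simp [hCl],
                extend P B C hCB hB hC⟩
            · exact Or.inr ⟨C, (hCB.trans hBA).cons a, hCl, hC⟩
          · rcases h₂ P B hBl.ge with ⟨C, hCB, hCl, hC⟩ | ⟨C, hCB, hCl, hC⟩
            · exact Or.inl ⟨C, (hCB.trans hBA).cons a, hCl, hC⟩
            · exact Or.inr ⟨a :: C, (hCB.trans hBA).cons_cons a, by simp [hCl],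
                extend (fun J => ¬ P J) B C hCB hB hC⟩

/-- If every subsequence of length `l` contains a `k`-subsequence with property `P`, then a long
list has a subsequence of length `n` all of whose `k`-subsequences have property `P`. -/
theorem ramsey_of_unavoidable (k l n : ℕ) : ∃ N : ℕ, ∀ {ι : Type} (P : List ι → Prop) (A : List ι),
    N ≤ A.length →
    (∀ B, B.Sublist A → B.length = l → ∃ J, J.Sublist B ∧ J.length = k ∧ P J) →
    ∃ B, B.Sublist A ∧ B.length = n ∧ ∀ J, J.Sublist B → J.length = k → P J := by
  obtain ⟨N, hN⟩ := ramsey_sublist k l n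
  refine ⟨N, fun P A hA h => (hN P A hA).resolve_right ?_⟩
  rintro ⟨B, hBA, hBl, hB⟩
  obtain ⟨J, hJ, hJl, hPJ⟩ := h B hBA hBl
  exact hB J hJ hJl hPJ

section Words
open scoped Classical

/-- In the word `L` of labelled indices, each earlier `true` is related to each later `false`. -/
def WordEvent {ι Ω : Type} (R : ι → ι → Ω → Prop) (v : Ω) (L : List (ι × Bool)) : Prop :=
  L.Pairwise fun p q => p.2 = true → q.2 = false → R p.1 q.1 v

/-- Dense families of relations have subsequences on which the word `u` occurs with positive
frequency. -/
def WordDense (u : List Bool) : Prop :=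
  ∀ ε : ℝ, 0 < ε → ∃ θ : ℝ, 0 < θ ∧ ∀ n : ℕ, ∃ N : ℕ, ∀ {ι Ω : Type} (G : Finset Ω)
    (R : ι → ι → Ω → Prop) (I : List ι), N ≤ I.length →
    (∀ i j, [i, j].Sublist I → ε * #G ≤ #{v ∈ G | R i j v}) →
    ∃ B : List ι, B.Sublist I ∧ B.length = n ∧ ∀ J : List ι, J.Sublist B → J.length = u.length →
      θ * #G ≤ #{v ∈ G | WordEvent R v (J.zip u)}

theorem sum_card_le_of_pairwise_inter {κ Ω : Type} (E : κ → Finset Ω) (δ : ℝ) (hδ : 0 ≤ δ) :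
    ∀ L : List κ, L.Pairwise (fun p q => (#(E p ∩ E q) : ℝ) ≤ δ) →
      ((L.map fun p => (#(E p) : ℝ)).sum) ≤
        #(L.toFinset.biUnion E) + (L.length : ℝ) ^ 2 * δ := by
  intro L
  induction L with
  | nil => intro _; simp
  | cons a L ih =>
    intro h
    rw [List.pairwise_cons] at h
    have h1 := ih h.2
    have h2 : (#(E a ∩ L.toFinset.biUnion E) : ℝ) ≤ L.length * δ := by
      rw [Finset.inter_biUnion]
      calc (#(L.toFinset.biUnion fun x => E a ∩ E x) : ℝ)
          ≤ ∑ x ∈ L.toFinset, (#(E a ∩ E x) : ℝ) := by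
            exact_mod_cast Finset.card_biUnion_le
        _ ≤ ∑ x ∈ L.toFinset, δ :=
            Finset.sum_le_sum fun x hx => h.1 x (by simpa using hx)
        _ ≤ L.length * δ := by
            rw [Finset.sum_const, nsmul_eq_mul]
            gcongr
            exact List.toFinset_card_le L
    have h3 : (#(E a ∪ L.toFinset.biUnion E) : ℝ) + #(E a ∩ L.toFinset.biUnion E) =
        #(E a) + #(L.toFinset.biUnion E) := by
      exact_mod_cast Finset.card_union_add_card_inter _ _
    rw [List.toFinset_cons, Finset.biUnion_insert]
    simp only [List.map_cons, List.sum_cons, List.length_cons]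
    push_cast
    have : (0 : ℝ) ≤ L.length := by positivity
    nlinarith [mul_nonneg this hδ]

theorem exists_pair_large_inter {κ Ω : Type} (G : Finset Ω) (E : κ → Finset Ω) (θ : ℝ)
    (L : List κ) (hL : 2 ≤ L.length) (hθ : 2 < L.length * θ)
    (hE : ∀ p ∈ L, E p ⊆ G) (hcard : ∀ p ∈ L, θ * #G ≤ #(E p)) :
    ∃ p q, [p, q].Sublist L ∧ (1 / (L.length : ℝ) ^ 2) * #G ≤ #(E p ∩ E q) := by
  by_contra! hcon
  have hpos : (0 : ℝ) < L.length := by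
    have : 0 < L.length := by omega
    exact_mod_cast this
  rcases Nat.eq_zero_or_pos #G with h0 | h0
  · match L, hL with
    | a :: b :: L, _ =>
      have := hcon a b (by simp)
      rw [h0] at this
      simp only [Nat.cast_zero, mul_zero] at this
      exact absurd this (not_lt.mpr (by positivity))
  · have h1 := sum_card_le_of_pairwise_inter E ((1 / (L.length : ℝ) ^ 2) * #G) (by positivity) L
      (List.pairwise_iff_forall_sublist.mpr fun {p q} h => (hcon p q h).le)
    have h2 : (L.length : ℝ) * (θ * #G) ≤ (L.map fun p => (#(E p) : ℝ)).sum := by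
      have := List.card_nsmul_le_sum (L.map fun p => (#(E p) : ℝ)) (θ * #G) (by
        intro x hx
        obtain ⟨p, hp, rfl⟩ := List.mem_map.mp hx
        exact hcard p hp)
      simpa [nsmul_eq_mul] using this
    have h3 : (#(L.toFinset.biUnion E) : ℝ) ≤ #G := by
      exact_mod_cast Finset.card_le_card
        (Finset.biUnion_subset.mpr fun p hp => hE p (by simpa using hp))
    have h4 : (L.length : ℝ) ^ 2 * ((1 / (L.length : ℝ) ^ 2) * #G) = #G := by
      field_simp
    have h5 : (0 : ℝ) < #G := by exact_mod_cast h0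
    nlinarith

theorem exists_chunks {ι : Type} (c : ℕ) : ∀ (K : ℕ) (A : List ι), A.length = K * c →
    ∃ L : List (List ι), L.length = K ∧ (∀ p ∈ L, p.length = c) ∧ L.flatten = A := by
  intro K
  induction K with
  | zero =>
    intro A hA
    exact ⟨[], rfl, by simp,
      by simpa using (List.length_eq_zero_iff.mp (by simpa using hA)).symm⟩
  | succ K ih =>
    intro A hA
    obtain ⟨L, h1, h2, h3⟩ := ih (A.drop c) (by simp [hA, Nat.succ_mul])
    refine ⟨A.take c :: L, by simp [h1], ?_, by simp [h3]⟩
    intro p hp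
    rcases List.mem_cons.mp hp with rfl | hp
    · simp only [List.length_take, hA, Nat.succ_mul]; omega
    · exact h2 p hp

/-- Two disjoint occurrences of a middle block can be merged into a new middle block. -/
theorem WordDense.merge {v w w' z : List Bool}
    (comb : ∀ {ι : Type}, List ι → List ι → List ι)
    (hlen : ∀ {ι : Type} (p q : List ι), p.length = w.length → q.length = w.length →
      (comb p q).length = w'.length ∧ (comb p q).Sublist (p ++ q))
    (hcomb : ∀ {ι Ω : Type} (R : ι → ι → Ω → Prop) (x : Ω) (a b p q : List ι),
      a.length = v.length → b.length = z.length → p.length = w.length → q.length = w.length →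
      WordEvent R x ((a ++ (p ++ b)).zip (v ++ (w ++ z))) →
      WordEvent R x ((a ++ (q ++ b)).zip (v ++ (w ++ z))) →
      WordEvent R x ((a ++ (comb p q ++ b)).zip (v ++ (w' ++ z))))
    (h : WordDense (v ++ (w ++ z))) : WordDense (v ++ (w' ++ z)) := by
  intro ε hε
  obtain ⟨θ, hθ, h⟩ := h ε hε
  obtain ⟨K, hK⟩ := exists_nat_gt (2 / θ)
  set K' := K + 2 with hK'
  have hKθ : 2 < (K' : ℝ) * θ := by
    rw [div_lt_iff₀ hθ] at hK
    rw [hK']; push_cast; nlinarith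
  refine ⟨1 / (K' : ℝ) ^ 2, by positivity, fun n => ?_⟩
  obtain ⟨N₁, hN₁⟩ := ramsey_of_unavoidable (v ++ (w' ++ z)).length
    (v.length + (K' * w.length + z.length)) n
  obtain ⟨N, hN⟩ := h N₁
  refine ⟨N, fun {ι Ω} G R I hI hR => ?_⟩
  obtain ⟨B, hBI, hBl, hB⟩ := hN G R I hI hR
  suffices hun : ∀ D, D.Sublist B → D.length = v.length + (K' * w.length + z.length) →
      ∃ J : List ι, J.Sublist D ∧ J.length = (v ++ (w' ++ z)).length ∧
        (1 / (K' : ℝ) ^ 2) * #G ≤ #{x ∈ G | WordEvent R x (J.zip (v ++ (w' ++ z)))} by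
    obtain ⟨C, hCB, hCl, hC⟩ := hN₁
      (fun J => (1 / (K' : ℝ) ^ 2) * #G ≤ #{x ∈ G | WordEvent R x (J.zip (v ++ (w' ++ z)))})
      B hBl.ge hun
    exact ⟨C, hCB.trans hBI, hCl, hC⟩
  intro D hDB hDl
  obtain ⟨a, s, b, rfl, ha, hs, hb⟩ : ∃ a s b : List ι, D = a ++ (s ++ b) ∧
      a.length = v.length ∧ s.length = K' * w.length ∧ b.length = z.length := by
    refine ⟨D.take v.length, (D.drop v.length).take (K' * w.length),
      (D.drop v.length).drop (K' * w.length), by simp, ?_, ?_, ?_⟩ <;>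
      simp only [List.length_take, List.length_drop, hDl] <;> omega
  obtain ⟨L, hLK, hLc, rfl⟩ := exists_chunks w.length K' s hs
  obtain ⟨p, q, hpq, hcard⟩ := exists_pair_large_inter G
    (fun p => {x ∈ G | WordEvent R x ((a ++ (p ++ b)).zip (v ++ (w ++ z)))}) θ L
    (by omega) (by rw [hLK]; exact hKθ) (fun p _ => Finset.filter_subset _ _)
    (fun p hp => hB _ ((((List.sublist_flatten_of_mem hp).append_right b).append_left a).trans hDB)
      (by simp [ha, hb, hLc p hp]))
  have hp : p.length = w.length := hLc p (hpq.subset (by simp))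
  have hq : q.length = w.length := hLc q (hpq.subset (by simp))
  have hsub : (p ++ q).Sublist L.flatten := by simpa using hpq.flatten
  refine ⟨a ++ (comb p q ++ b),
    ((((hlen p q hp hq).2.trans hsub).append_right b).append_left a), ?_, ?_⟩
  · simp [ha, hb, (hlen p q hp hq).1]
  · rw [hLK] at hcard
    refine hcard.trans ?_
    norm_cast
    refine Finset.card_le_card fun x hx => ?_
    simp only [Finset.mem_inter, Finset.mem_filter] at hx ⊢
    exact ⟨hx.1.1, hcomb R x a b p q ha hb hp hq hx.1.2 hx.2.2⟩

theorem WordDense.dup {v z : List Bool} {x : Bool} (h : WordDense (v ++ ([x] ++ z))) :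
    WordDense (v ++ ([x, x] ++ z)) := by
  refine WordDense.merge (fun p q => p ++ q) (fun p q hp hq => ?_) ?_ h
  · simp_all
  · intro ι Ω R y a b p q ha hb hp hq
    obtain ⟨p, rfl⟩ := List.length_eq_one_iff.mp hp
    obtain ⟨q, rfl⟩ := List.length_eq_one_iff.mp hq
    simp only [WordEvent, List.zip_append ha, List.cons_append, List.nil_append,
      List.zip_cons_cons, List.pairwise_append, List.pairwise_cons, List.mem_cons]
    grind

theorem WordDense.swap {v z : List Bool} (h : WordDense (v ++ ([true, false] ++ z))) :
    WordDense (v ++ ([false, true] ++ z)) := by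
  refine WordDense.merge (fun p q => p.drop 1 ++ q.take 1) (fun p q hp hq => ?_) ?_ h
  · exact ⟨by simp_all, (List.drop_sublist 1 p).append (List.take_sublist 1 q)⟩
  · intro ι Ω R y a b p q ha hb hp hq
    obtain ⟨p, p', rfl⟩ := List.length_eq_two.mp hp
    obtain ⟨q, q', rfl⟩ := List.length_eq_two.mp hq
    simp only [WordEvent, List.zip_append ha, List.cons_append, List.nil_append,
      List.drop_succ_cons,
      List.drop_zero, List.take_succ_cons, List.take_zero,
      List.zip_cons_cons, List.pairwise_append, List.pairwise_cons, List.mem_cons]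
    grind

theorem wordDense_true_false : WordDense [true, false] := by
  intro ε hε
  refine ⟨ε, hε, fun n => ⟨n, fun {ι Ω} G R I hI hR =>
    ⟨I.take n, I.take_sublist n, by simp [hI], ?_⟩⟩⟩
  intro J hJ hl
  obtain ⟨i, j, rfl⟩ := List.length_eq_two.mp hl
  simpa [WordEvent] using hR i j (hJ.trans (I.take_sublist n))

/-- The alternating word of length `2 * k`. -/
def altWord (k : ℕ) : List Bool := (List.replicate k [true, false]).flatten

theorem wordDense_altWord (k : ℕ) : WordDense (altWord (k + 1)) := by
  induction k with
  | zero => exact wordDense_true_false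
  | succ k ih =>
    have h0 : WordDense ([] ++ ([true] ++ ([false] ++ altWord k))) := ih
    have h1 : WordDense ([true, true] ++ ([false] ++ altWord k)) := h0.dup
    have h2 : WordDense ([true] ++ ([true, false] ++ ([false] ++ altWord k))) := h1.dup
    exact h2.swap

theorem WordDense.pages {u : List Bool} (hu : WordDense u) (ε : ℝ) (hε : 0 < ε) :
    ∃ θ : ℝ, 0 < θ ∧ ∀ t n : ℕ, ∃ N : ℕ, ∀ {ι Ω κ : Type} (G : κ → Finset Ω)
      (R : κ → ι → ι → Ω → Prop) (I : List ι) (Ks : List κ), Ks.length = t → N ≤ I.length →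
      (∀ w ∈ Ks, ∀ i j, [i, j].Sublist I → ε * #(G w) ≤ #{v ∈ G w | R w i j v}) →
      ∃ B : List ι, B.Sublist I ∧ B.length = n ∧
        ∀ w ∈ Ks, ∀ J : List ι, J.Sublist B → J.length = u.length →
        θ * #(G w) ≤ #{v ∈ G w | WordEvent (R w) v (J.zip u)} := by
  obtain ⟨θ, hθ, h⟩ := hu ε hε
  refine ⟨θ, hθ, fun t => ?_⟩
  induction t with
  | zero =>
    refine fun n => ⟨n, fun {ι Ω κ} G R I Ks hK hI _ =>
      ⟨I.take n, I.take_sublist n, by simp [hI], ?_⟩⟩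
    simp [List.length_eq_zero_iff.mp hK]
  | succ t ih =>
    intro n
    obtain ⟨N₁, h₁⟩ := ih n
    obtain ⟨N, h₂⟩ := h N₁
    refine ⟨N, fun {ι Ω κ} G R I Ks hK hI hR => ?_⟩
    match Ks, hK with
    | w :: Ks, hK =>
      obtain ⟨B, hBI, hBl, hB⟩ := h₂ (G w) (R w) I hI (hR w (by simp))
      obtain ⟨C, hCB, hCl, hC⟩ := h₁ G R B Ks (by simpa using hK) hBl.ge
        (fun w' hw' i j hij => hR w' (by simp [hw']) i j (hij.trans hBI))
      refine ⟨C, hCB.trans hBI, hCl, fun w' hw' J hJ => ?_⟩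
      rcases List.mem_cons.mp hw' with rfl | hw'
      · exact hB J (hJ.trans hCB)
      · exact hC w' hw' J hJ

theorem exists_sublist_altWord {ι : Type} (lab : ι → Bool) : ∀ (k : ℕ) (L : List (List ι)),
    L.length = k → (∀ p ∈ L, p.length = 3) →
    ∃ J : List ι, J.Sublist L.flatten ∧ J.length = (altWord k).length ∧
      ((L.map fun p => p.tail.take 1).flatten.map fun x => (x, lab x)).Sublist
        (J.zip (altWord k)) := by
  intro k
  induction k with
  | zero =>
    intro L hL _
    exact ⟨[], by simp, by simp [altWord], by simp [List.length_eq_zero_iff.mp hL]⟩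
  | succ k ih =>
    intro L hL h3
    match L, hL with
    | p :: L, hL =>
      obtain ⟨J, h1, h2, h4⟩ := ih L (by simpa using hL) (fun q hq => h3 q (by simp [hq]))
      obtain ⟨z, x, z', rfl⟩ := List.length_eq_three.mp (h3 p (by simp))
      have hw : altWord (k + 1) = true :: false :: altWord k := rfl
      cases hx : lab x with
      | true =>
        refine ⟨x :: z' :: J, ?_, by simp [hw, h2], ?_⟩
        · simp [h1]
        · rw [hw]
          simpa [hx] using h4.cons _
      | false =>
        refine ⟨z :: x :: J, ?_, by simp [hw, h2], ?_⟩
        · simp only [List.flatten_cons, List.cons_append, List.nil_append, List.cons_sublist_cons]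
          exact h1.cons _
        · rw [hw]
          simp only [List.map_cons, List.tail_cons, List.take_succ_cons, List.take_zero,
            List.flatten_cons, List.cons_append, List.nil_append, hx, List.zip_cons_cons]
          exact (h4.cons_cons _).cons _

/-- From relations that are dense for each page, extract a subsequence on which every labelling
pattern is realised with positive frequency on every page. -/
theorem exists_label_dense (m : ℕ) (ε : ℝ) (hε : 0 < ε) :
    ∃ θ : ℝ, 0 < θ ∧ ∃ N : ℕ, ∀ {ι Ω κ : Type} (G : κ → Finset Ω)
      (R : κ → ι → ι → Ω → Prop) (I : List ι) (Ks : List κ), Ks.length = m → N ≤ I.length →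
      (∀ w ∈ Ks, ∀ i j, [i, j].Sublist I → ε * #(G w) ≤ #{v ∈ G w | R w i j v}) →
      ∃ J : List ι, J.Sublist I ∧ J.length = m ∧ ∀ w ∈ Ks, ∀ lab : ι → Bool,
        θ * #(G w) ≤
          #{v ∈ G w | J.Pairwise fun x y => lab x = true → lab y = false → R w x y v} := by
  rcases Nat.eq_zero_or_pos m with rfl | hm
  · exact ⟨1, one_pos, 0, fun {ι Ω κ} G R I Ks _ _ _ => ⟨[], by simp, rfl, by simp⟩⟩
  obtain ⟨k, rfl⟩ : ∃ k, m = k + 1 := ⟨m - 1, by omega⟩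
  obtain ⟨θ, hθ, h⟩ := (wordDense_altWord k).pages ε hε
  obtain ⟨N, hN⟩ := h (k + 1) ((k + 1) * 3)
  refine ⟨θ, hθ, N, fun {ι Ω κ} G R I Ks hK hI hR => ?_⟩
  obtain ⟨B, hBI, hBl, hB⟩ := hN G R I Ks hK hI hR
  obtain ⟨L, hLk, hL3, rfl⟩ := exists_chunks 3 (k + 1) B hBl
  refine ⟨(L.map fun p => p.tail.take 1).flatten, ?_, ?_, fun w hw lab => ?_⟩
  · refine List.Sublist.trans ?_ hBI
    clear hBl hBI hB hLk hL3
    induction L with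
    | nil => simp
    | cons p L ih =>
      simp only [List.map_cons, List.flatten_cons]
      exact ((List.take_sublist _ _).trans (List.tail_sublist p)).append ih
  · rw [List.length_flatten, List.map_map, List.map_congr_left (g := fun _ => 1)]
    · simp [hLk]
    · intro p hp
      simp [hL3 p hp]
  · obtain ⟨J, h1, h2, h3⟩ := exists_sublist_altWord lab (k + 1) L hLk hL3
    refine (hB w hw J h1 h2).trans ?_
    norm_cast
    refine Finset.card_le_card fun x hx => ?_
    simp only [Finset.mem_filter] at hx ⊢
    refine ⟨hx.1, ?_⟩
    have := hx.2.sublist h3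
    rw [List.pairwise_map] at this
    exact this

end Words

section Boxes
open scoped Classical

variable {ι V : Type} [Fintype ι]

/-- The point `x` maps every member of `T` to a member of `E`. -/
def Hits (E : Finset (Finset V)) (T : Finset (Finset ι)) (x : ι → V) : Prop :=
  ∀ e ∈ T, e.image x ∈ E

/-- The number of points of the box `D` mapping every member of `T` to a member of `E`. -/
noncomputable def boxCount (E : Finset (Finset V)) (D : ι → Finset V) (T : Finset (Finset ι)) : ℕ :=
  #{x ∈ Fintype.piFinset D | Hits E T x}

/-- The number of points of a box, as a real number. -/
noncomputable def boxVol (D : ι → Finset V) : ℝ := ∏ i, (#(D i) : ℝ)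

/-- The proportion of points of the box `D` mapping every member of `T` to a member of `E`. -/
noncomputable def boxDens (E : Finset (Finset V)) (D : ι → Finset V) (T : Finset (Finset ι)) : ℝ :=
  boxCount E D T / boxVol D

/-- The energy of a box. -/
noncomputable def boxEnergy (E : Finset (Finset V)) (D : ι → Finset V) : ℝ :=
  ∑ T : Finset (Finset ι), boxDens E D T ^ 2

theorem card_piFinset_eq_boxVol (D : ι → Finset V) :
    (#(Fintype.piFinset D) : ℝ) = boxVol D := by
  simp [boxVol, Fintype.card_piFinset]

theorem boxVol_pos {D : ι → Finset V} (h : ∀ i, 0 < #(D i)) : 0 < boxVol D :=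
  Finset.prod_pos fun i _ => by exact_mod_cast h i

theorem boxVol_nonneg (D : ι → Finset V) : 0 ≤ boxVol D :=
  Finset.prod_nonneg fun i _ => by positivity

theorem boxCount_le_boxVol (E : Finset (Finset V)) (D : ι → Finset V) (T : Finset (Finset ι)) :
    (boxCount E D T : ℝ) ≤ boxVol D := by
  rw [← card_piFinset_eq_boxVol]
  exact_mod_cast Finset.card_filter_le _ _

theorem boxDens_nonneg (E : Finset (Finset V)) (D : ι → Finset V) (T : Finset (Finset ι)) :
    0 ≤ boxDens E D T := div_nonneg (by positivity) (boxVol_nonneg D)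

theorem boxDens_le_one (E : Finset (Finset V)) (D : ι → Finset V) (T : Finset (Finset ι)) :
    boxDens E D T ≤ 1 :=
  div_le_one_of_le₀ (boxCount_le_boxVol E D T) (boxVol_nonneg D)

theorem boxDens_mul_boxVol (E : Finset (Finset V)) {D : ι → Finset V} (h : ∀ i, 0 < #(D i))
    (T : Finset (Finset ι)) : boxDens E D T * boxVol D = boxCount E D T :=
  div_mul_cancel₀ _ (boxVol_pos h).ne'

theorem boxEnergy_le (E : Finset (Finset V)) (D : ι → Finset V) :
    boxEnergy E D ≤ Fintype.card (Finset (Finset ι)) := by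
  calc boxEnergy E D ≤ ∑ T : Finset (Finset ι), (1 : ℝ) :=
        Finset.sum_le_sum fun T _ =>
          pow_le_one₀ (boxDens_nonneg E D T) (boxDens_le_one E D T)
    _ = _ := by simp

theorem boxEnergy_nonneg (E : Finset (Finset V)) (D : ι → Finset V) : 0 ≤ boxEnergy E D :=
  Finset.sum_nonneg fun _ _ => sq_nonneg _

theorem boxVol_update_erase (B : ι → Finset V) (i : ι) {a : V} (ha : a ∈ B i) :
    (#(B i) : ℝ) * boxVol (Function.update B i ((B i).erase a)) = (#(B i) - 1) * boxVol B := by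
  unfold boxVol
  rw [← Finset.mul_prod_erase _ _ (Finset.mem_univ i),
    ← Finset.mul_prod_erase univ (fun j => (#(B j) : ℝ)) (Finset.mem_univ i)]
  have : ∏ x ∈ univ.erase i, (#(Function.update B i ((B i).erase a) x) : ℝ) =
      ∏ x ∈ univ.erase i, (#(B x) : ℝ) :=
    Finset.prod_congr rfl fun j hj => by rw [Function.update_of_ne (Finset.ne_of_mem_erase hj)]
  rw [this, Function.update_self, Finset.cast_card_erase_of_mem ha]
  ring

theorem sum_boxCount_update_erase (E : Finset (Finset V)) (B : ι → Finset V) (i : ι)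
    (T : Finset (Finset ι)) :
    ∑ a ∈ B i, (boxCount E (Function.update B i ((B i).erase a)) T : ℝ) =
      (#(B i) - 1) * boxCount E B T := by
  have key : ∀ a ∈ B i, (boxCount E (Function.update B i ((B i).erase a)) T : ℝ) =
      ∑ x ∈ Fintype.piFinset B with Hits E T x, if x i ≠ a then (1 : ℝ) else 0 := by
    intro a _
    rw [Finset.sum_boole, Finset.filter_filter, boxCount]
    congr 2
    ext x
    simp only [Finset.mem_filter, Fintype.mem_piFinset]
    constructor
    · rintro ⟨h, hT⟩
      refine ⟨fun j => ?_, hT, ?_⟩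
      · by_cases hj : j = i
        · subst hj; have := h j; simp at this; exact this.2
        · simpa [hj] using h j
      · have := h i; simp at this; exact this.1
    · rintro ⟨h, hT, hne⟩
      refine ⟨fun j => ?_, hT⟩
      by_cases hj : j = i
      · subst hj; simp [hne, h j]
      · simpa [hj] using h j
  rw [Finset.sum_congr rfl key, Finset.sum_comm, boxCount]
  have : ∀ x ∈ (Fintype.piFinset B).filter (fun x => Hits E T x),
      (∑ a ∈ B i, if x i ≠ a then (1 : ℝ) else 0) = #(B i) - 1 := by
    intro x hx
    have hxi : x i ∈ B i := Fintype.mem_piFinset.mp (Finset.mem_filter.mp hx).1 i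
    rw [Finset.sum_boole, Finset.filter_ne, Finset.cast_card_erase_of_mem hxi]
  rw [Finset.sum_congr rfl this, Finset.sum_const, nsmul_eq_mul, mul_comm]

theorem sum_boxDens_update_erase (E : Finset (Finset V)) (B : ι → Finset V) (i : ι)
    (hB : ∀ j, 0 < #(B j)) (hi : 2 ≤ #(B i)) (T : Finset (Finset ι)) :
    ∑ a ∈ B i, boxDens E (Function.update B i ((B i).erase a)) T = #(B i) * boxDens E B T := by
  have hb : (0 : ℝ) < #(B i) := by exact_mod_cast hB i
  have hb1 : (0 : ℝ) < #(B i) - 1 := by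
    have : (2 : ℝ) ≤ #(B i) := by exact_mod_cast hi
    linarith
  have hv := boxVol_pos hB
  have h1 : ∀ a ∈ B i, boxDens E (Function.update B i ((B i).erase a)) T =
      (#(B i) / ((#(B i) - 1) * boxVol B)) *
        boxCount E (Function.update B i ((B i).erase a)) T := by
    intro a ha
    have h := boxVol_update_erase B i ha
    have : boxVol (Function.update B i ((B i).erase a)) = (#(B i) - 1) * boxVol B / #(B i) := by
      field_simp; linarith
    rw [boxDens, this]
    field_simp
  rw [Finset.sum_congr rfl h1, ← Finset.mul_sum, sum_boxCount_update_erase, boxDens]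
  field_simp

/-- A functional that does not decrease on average when one point is removed can be kept from
decreasing while shrinking the box to prescribed side lengths. -/
theorem exists_shrink (ψ : (ι → Finset V) → ℝ) (t : ℕ) (ht : 1 ≤ t)
    (hψ : ∀ (B : ι → Finset V) (i : ι), (∀ j, 0 < #(B j)) → 2 ≤ #(B i) →
      #(B i) * ψ B ≤ ∑ a ∈ B i, ψ (Function.update B i ((B i).erase a))) :
    ∀ (N : ℕ) (B : ι → Finset V), (∀ i, t ≤ #(B i)) → (∑ i, #(B i) = N) →
      ∃ D : ι → Finset V, (∀ i, D i ⊆ B i) ∧ (∀ i, #(D i) = t) ∧ ψ B ≤ ψ D := by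
  intro N
  induction N using Nat.strong_induction_on with
  | _ N ih =>
    intro B hB hN
    by_cases h : ∀ i, #(B i) = t
    · exact ⟨B, fun _ => Subset.rfl, h, le_rfl⟩
    push Not at h
    obtain ⟨i, hi⟩ := h
    have hi' : t < #(B i) := lt_of_le_of_ne (hB i) hi.symm
    have hne : (B i).Nonempty := Finset.card_pos.mp (by omega)
    have hsum := hψ B i (fun j => by have := hB j; omega) (by omega)
    obtain ⟨a, ha, hle⟩ : ∃ a ∈ B i, ψ B ≤ ψ (Function.update B i ((B i).erase a)) := by
      apply Finset.exists_le_of_sum_le hne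
      simpa using hsum
    have hcard : ∀ j, #(Function.update B i ((B i).erase a) j) =
        if j = i then #(B i) - 1 else #(B j) := by
      intro j
      by_cases hj : j = i
      · subst hj; simp [Finset.card_erase_of_mem ha]
      · simp [hj]
    have hsub : ∀ j, Function.update B i ((B i).erase a) j ⊆ B j := by
      intro j
      by_cases hj : j = i
      · subst hj; simpa using Finset.erase_subset a (B j)
      · simp [hj]
    have hlt : ∑ j, #(Function.update B i ((B i).erase a) j) < N := by
      rw [← hN]
      refine Finset.sum_lt_sum (fun j _ => Finset.card_le_card (hsub j)) ⟨i, Finset.mem_univ i, ?_⟩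
      rw [hcard]; simp; omega
    obtain ⟨D, h1, h2, h3⟩ := ih _ hlt (Function.update B i ((B i).erase a)) (fun j => by
      rw [hcard]; split_ifs
      · omega
      · exact hB j) rfl
    exact ⟨D, fun j => (h1 j).trans (hsub j), h2, hle.trans h3⟩

theorem exists_shrink_boxDens (E : Finset (Finset V)) (T : Finset (Finset ι)) (t : ℕ) (ht : 1 ≤ t)
    (B : ι → Finset V) (hB : ∀ i, t ≤ #(B i)) :
    ∃ D : ι → Finset V, (∀ i, D i ⊆ B i) ∧ (∀ i, #(D i) = t) ∧ boxDens E D T ≤ boxDens E B T := by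
  obtain ⟨D, h1, h2, h3⟩ := exists_shrink (fun D => - boxDens E D T) t ht
    (fun B i h0 h2 => by
      rw [Finset.sum_neg_distrib, sum_boxDens_update_erase E B i h0 h2]; simp) _ B hB rfl
  exact ⟨D, h1, h2, neg_le_neg_iff.mp h3⟩

theorem exists_shrink_boxEnergy (E : Finset (Finset V)) (t : ℕ) (ht : 1 ≤ t)
    (B : ι → Finset V) (hB : ∀ i, t ≤ #(B i)) :
    ∃ D : ι → Finset V, (∀ i, D i ⊆ B i) ∧ (∀ i, #(D i) = t) ∧ boxEnergy E B ≤ boxEnergy E D := by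
  refine exists_shrink (boxEnergy E) t ht (fun B i h0 h2 => ?_) _ B hB rfl
  unfold boxEnergy
  rw [Finset.sum_comm, Finset.mul_sum]
  refine Finset.sum_le_sum fun T _ => ?_
  have h := sum_boxDens_update_erase E B i h0 h2 T
  have hcs := sq_sum_le_card_mul_sum_sq (s := B i)
    (f := fun a => boxDens E (Function.update B i ((B i).erase a)) T)
  rw [h] at hcs
  have hb : (0 : ℝ) < #(B i) := by exact_mod_cast h0 i
  have : (#(B i) : ℝ) * (#(B i) * boxDens E B T ^ 2) ≤
      #(B i) * ∑ a ∈ B i, boxDens E (Function.update B i ((B i).erase a)) T ^ 2 := by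
    calc _ = (#(B i) * boxDens E B T) ^ 2 := by ring
      _ ≤ _ := hcs
  exact le_of_mul_le_mul_left this hb

/-- The part of `B` on the side of `D` prescribed by `c`. -/
noncomputable def boxPart (B D : ι → Finset V) (c : ι → Bool) : ι → Finset V :=
  fun i => if c i then D i else B i \ D i

theorem sum_piFinset_boxPart (B D : ι → Finset V) (hD : ∀ i, D i ⊆ B i) (p : (ι → V) → Prop) :
    #{x ∈ Fintype.piFinset B | p x} =
      ∑ c : ι → Bool, #{x ∈ Fintype.piFinset (boxPart B D c) | p x} := by
  rw [Finset.card_eq_sum_card_fiberwise (f := fun x i => decide (x i ∈ D i)) (t := Finset.univ)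
    (fun x _ => Finset.mem_coe.mpr (Finset.mem_univ _))]
  refine Finset.sum_congr rfl fun c _ => ?_
  congr 1
  ext x
  simp only [Finset.mem_filter, Fintype.mem_piFinset, boxPart]
  constructor
  · rintro ⟨⟨h, hp⟩, rfl⟩
    refine ⟨fun i => ?_, hp⟩
    by_cases hi : x i ∈ D i <;> simp [hi, h i]
  · rintro ⟨h, hp⟩
    refine ⟨⟨fun i => ?_, hp⟩, ?_⟩
    · have := h i
      split_ifs at this
      · exact hD i this
      · exact (Finset.mem_sdiff.mp this).1
    · funext i
      have := h i
      cases hc : c i <;> simp [hc] at this <;> simp [this]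

theorem boxDens_eq_sum_boxPart (E : Finset (Finset V)) (B D : ι → Finset V) (hD : ∀ i, D i ⊆ B i)
    (hpos : ∀ c i, 0 < #(boxPart B D c i)) (T : Finset (Finset ι)) :
    boxVol B * boxDens E B T = ∑ c, boxVol (boxPart B D c) * boxDens E (boxPart B D c) T := by
  have hB : ∀ i, 0 < #(B i) := fun i =>
    (hpos (fun _ => true) i).trans_le (Finset.card_le_card (by simpa [boxPart] using hD i))
  rw [mul_comm, boxDens_mul_boxVol E hB, boxCount, sum_piFinset_boxPart B D hD]
  push_cast
  refine Finset.sum_congr rfl fun c _ => ?_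
  rw [mul_comm, boxDens_mul_boxVol E (hpos c), boxCount]

theorem boxVol_eq_sum_boxPart (B D : ι → Finset V) (hD : ∀ i, D i ⊆ B i) :
    boxVol B = ∑ c, boxVol (boxPart B D c) := by
  have := sum_piFinset_boxPart B D hD (fun _ => True)
  simp only [Finset.filter_true] at this
  simp only [← card_piFinset_eq_boxVol]
  exact_mod_cast this

/-- Energy increment. -/
theorem exists_boxPart_energy (E : Finset (Finset V)) (B D : ι → Finset V) (hD : ∀ i, D i ⊆ B i)
    (hpos : ∀ c i, 0 < #(boxPart B D c i)) (T₀ : Finset (Finset ι)) (γ ρ : ℝ) (hγ : 0 ≤ γ)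
    (hT : boxDens E D T₀ ≤ boxDens E B T₀ - γ) (hρ : ρ * boxVol B ≤ boxVol D) :
    ∃ c, boxEnergy E B + ρ * γ ^ 2 ≤ boxEnergy E (boxPart B D c) := by
  by_contra! hcon
  have hD1 : boxPart B D (fun _ => true) = D := by funext i; simp [boxPart]
  have hw : ∀ c, 0 < boxVol (boxPart B D c) := fun c => boxVol_pos (hpos c)
  have hlt : ∑ c, boxVol (boxPart B D c) * boxEnergy E (boxPart B D c) <
      ∑ c, boxVol (boxPart B D c) * (boxEnergy E B + ρ * γ ^ 2) :=
    Finset.sum_lt_sum_of_nonempty Finset.univ_nonempty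
      fun c _ => mul_lt_mul_of_pos_left (hcon c) (hw c)
  rw [← Finset.sum_mul, ← boxVol_eq_sum_boxPart B D hD] at hlt
  -- the variance of each density is nonnegative, and large for `T₀`
  have hvar : ∀ T, ∑ c, boxVol (boxPart B D c) *
      (boxDens E (boxPart B D c) T - boxDens E B T) ^ 2 =
      ∑ c, boxVol (boxPart B D c) * boxDens E (boxPart B D c) T ^ 2 -
        boxVol B * boxDens E B T ^ 2 := by
    intro T
    have h1 := boxDens_eq_sum_boxPart E B D hD hpos T
    have h2 := boxVol_eq_sum_boxPart B D hD
    calc _ = ∑ c, (boxVol (boxPart B D c) * boxDens E (boxPart B D c) T ^ 2 -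
          2 * boxDens E B T * (boxVol (boxPart B D c) * boxDens E (boxPart B D c) T) +
          boxDens E B T ^ 2 * boxVol (boxPart B D c)) :=
          Finset.sum_congr rfl fun c _ => by ring
      _ = _ := by
        rw [Finset.sum_add_distrib, Finset.sum_sub_distrib, ← Finset.mul_sum, ← Finset.mul_sum,
          ← h1, ← h2]
        ring
  have hnn : ∀ T, 0 ≤ ∑ c, boxVol (boxPart B D c) *
      (boxDens E (boxPart B D c) T - boxDens E B T) ^ 2 := fun T =>
    Finset.sum_nonneg fun c _ => mul_nonneg (hw c).le (sq_nonneg _)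
  have hT₀ : ρ * boxVol B * γ ^ 2 ≤ ∑ c, boxVol (boxPart B D c) *
      (boxDens E (boxPart B D c) T₀ - boxDens E B T₀) ^ 2 := by
    calc ρ * boxVol B * γ ^ 2 ≤ boxVol D * (boxDens E D T₀ - boxDens E B T₀) ^ 2 := by
          have : γ ^ 2 ≤ (boxDens E D T₀ - boxDens E B T₀) ^ 2 := by nlinarith
          calc _ ≤ boxVol D * γ ^ 2 := by gcongr
            _ ≤ _ := mul_le_mul_of_nonneg_left this (boxVol_nonneg D)
      _ = boxVol (boxPart B D fun _ => true) *
          (boxDens E (boxPart B D fun _ => true) T₀ - boxDens E B T₀) ^ 2 := by rw [hD1]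
      _ ≤ _ := Finset.single_le_sum
          (f := fun c => boxVol (boxPart B D c) *
            (boxDens E (boxPart B D c) T₀ - boxDens E B T₀) ^ 2)
          (fun c _ => mul_nonneg (hw c).le (sq_nonneg _)) (Finset.mem_univ _)
  have hall : ρ * boxVol B * γ ^ 2 ≤ ∑ T, ∑ c, boxVol (boxPart B D c) *
      (boxDens E (boxPart B D c) T - boxDens E B T) ^ 2 :=
    hT₀.trans (Finset.single_le_sum (f := fun T => ∑ c, boxVol (boxPart B D c) *
      (boxDens E (boxPart B D c) T - boxDens E B T) ^ 2) (fun T _ => hnn T) (Finset.mem_univ T₀))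
  simp only [hvar, Finset.sum_sub_distrib] at hall
  rw [Finset.sum_comm, ← Finset.mul_sum] at hall
  simp only [← Finset.mul_sum] at hall
  unfold boxEnergy at hlt
  linarith

/-- Every large sub-box of `B` has at least the densities of `B`, up to `γ`. -/
def LowerRegular (E : Finset (Finset V)) (B : ι → Finset V) (r : ℕ) (γ : ℝ) : Prop :=
  ∀ D : ι → Finset V, (∀ i, D i ⊆ B i) → (∀ i, #(B i) ≤ r * #(D i)) →
    ∀ T, boxDens E B T - γ ≤ boxDens E D T

theorem exists_lowerRegular_of_energy (E : Finset (Finset V)) (r : ℕ) (hr : 2 ≤ r) (γ : ℝ)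
    (hγ : 0 < γ) (m : ℕ) (hm : 1 ≤ m) :
    ∀ (K : ℕ) (B : ι → Finset V), (∀ i, #(B i) = m * r ^ K) →
      (Fintype.card (Finset (Finset ι)) : ℝ) <
        boxEnergy E B + K * (((1 : ℝ) / r) ^ Fintype.card ι * γ ^ 2) →
      ∃ (D : ι → Finset V) (s : ℕ), (∀ i, D i ⊆ B i) ∧ (∀ i, #(D i) = s) ∧ m ≤ s ∧
        LowerRegular E D r γ := by
  intro K
  induction K with
  | zero =>
    intro B _ h
    have := boxEnergy_le E B
    simp only [Nat.cast_zero, zero_mul, add_zero] at h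
    linarith
  | succ K ih =>
    intro B hB hen
    by_cases hreg : LowerRegular E B r γ
    · exact ⟨B, m * r ^ (K + 1), fun _ => Subset.rfl, hB,
        Nat.le_mul_of_pos_right m (by positivity), hreg⟩
    unfold LowerRegular at hreg
    push Not at hreg
    obtain ⟨D₀, hD₀, hcard, T, hT⟩ := hreg
    have ht : 1 ≤ m * r ^ K := Nat.mul_pos hm (by positivity)
    have hD₀' : ∀ i, m * r ^ K ≤ #(D₀ i) := fun i => by
      have h := hcard i
      rw [hB i, pow_succ] at h
      exact Nat.le_of_mul_le_mul_left (by linarith : r * (m * r ^ K) ≤ r * #(D₀ i)) (by omega)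
    obtain ⟨D, hDD, hDc, hDT⟩ := exists_shrink_boxDens E T (m * r ^ K) ht D₀ hD₀'
    have hDB : ∀ i, D i ⊆ B i := fun i => (hDD i).trans (hD₀ i)
    have hparts : ∀ c i, m * r ^ K ≤ #(boxPart B D c i) := by
      intro c i
      unfold boxPart
      split_ifs
      · exact (hDc i).ge
      · rw [Finset.card_sdiff_of_subset (hDB i), hDc, hB, pow_succ]
        have : m * r ^ K * 2 ≤ m * r ^ K * r := Nat.mul_le_mul_left _ hr
        rw [← mul_assoc]
        omega
    have hrpos : (0 : ℝ) < r := by exact_mod_cast (by omega : 0 < r)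
    obtain ⟨c, hc⟩ := exists_boxPart_energy E B D hDB (fun c i => ht.trans (hparts c i)) T γ
      (((1 : ℝ) / r) ^ Fintype.card ι) hγ.le (by linarith) (by
        unfold boxVol
        simp only [hB, hDc, Finset.prod_const, Finset.card_univ]
        rw [← mul_pow]
        apply le_of_eq
        congr 1
        push_cast
        field_simp
        ring)
    obtain ⟨C, hCC, hCc, hCe⟩ := exists_shrink_boxEnergy E (m * r ^ K) ht (boxPart B D c) (hparts c)
    obtain ⟨D', s, h1, h2, h3, h4⟩ := ih C hCc (by push_cast at hen; linarith)
    refine ⟨D', s, fun i => (h1 i).trans ((hCC i).trans ?_), h2, h3, h4⟩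
    unfold boxPart
    split_ifs
    · exact hDB i
    · exact Finset.sdiff_subset

/-- Existence of lower regular equitable families of disjoint clusters. -/
theorem exists_lowerRegular (Q r : ℕ) (hr : 2 ≤ r) (γ : ℝ) (hγ : 0 < γ) :
    ∃ K : ℕ, ∀ (n m : ℕ) (E : Finset (Finset (Fin n))), 1 ≤ m → Q * (m * r ^ K) ≤ n →
      ∃ (B : Fin Q → Finset (Fin n)) (s : ℕ), (∀ i j, i ≠ j → Disjoint (B i) (B j)) ∧
        (∀ i, #(B i) = s) ∧ m ≤ s ∧ LowerRegular E B r γ := by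
  have hrpos : (0 : ℝ) < r := by exact_mod_cast (by omega : 0 < r)
  obtain ⟨K, hK⟩ := exists_nat_gt ((Fintype.card (Finset (Finset (Fin Q))) : ℝ) /
    (((1 : ℝ) / r) ^ Fintype.card (Fin Q) * γ ^ 2))
  refine ⟨K, fun n m E hm hn => ?_⟩
  set b := m * r ^ K with hb
  have hinj : ∀ i : Fin Q, ∀ a : Fin b, i.val * b + a.val < n := fun i a => by
    calc i.val * b + a.val < i.val * b + b := by omega
      _ = (i.val + 1) * b := by ring
      _ ≤ Q * b := Nat.mul_le_mul_right _ i.isLt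
      _ ≤ n := hn
  let B : Fin Q → Finset (Fin n) := fun i =>
    Finset.univ.image fun a : Fin b => (⟨i.val * b + a.val, hinj i a⟩ : Fin n)
  have hBc : ∀ i, #(B i) = b := by
    intro i
    rw [Finset.card_image_of_injective]
    · simp
    · intro a a' h
      simp only [Fin.mk.injEq] at h
      exact Fin.ext (by omega)
  have hBd : ∀ i j, i ≠ j → Disjoint (B i) (B j) := by
    intro i j hij
    rw [Finset.disjoint_left]
    intro v hv hv'
    simp only [B, Finset.mem_image, Finset.mem_univ, true_and] at hv hv'
    obtain ⟨a, rfl⟩ := hv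
    obtain ⟨a', h⟩ := hv'
    simp only [Fin.mk.injEq] at h
    apply hij
    have hbpos : 0 < b := a.pos
    have h1 : (j.val * b + a'.val) / b = j.val := by
      rw [mul_comm, Nat.mul_add_div hbpos, Nat.div_eq_of_lt a'.isLt]; simp
    have h2 : (i.val * b + a.val) / b = i.val := by
      rw [mul_comm, Nat.mul_add_div hbpos, Nat.div_eq_of_lt a.isLt]; simp
    rw [h, h2] at h1
    exact Fin.ext h1
  obtain ⟨D, s, h1, h2, h3, h4⟩ := exists_lowerRegular_of_energy E r hr γ hγ m hm K B hBc (by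
    rw [div_lt_iff₀ (by positivity)] at hK
    have := boxEnergy_nonneg E B
    linarith)
  exact ⟨D, s, fun i j hij => Disjoint.mono (h1 i) (h1 j) (hBd i j hij), h2, h3, h4⟩

end Boxes

section Mixing
open scoped Classical

variable {ι V : Type} [Fintype ι]

/-- The box of all values which, on each coordinate in `W`, complete `y` to the pattern `S`. -/
noncomputable def fiberBox (E : Finset (Finset V)) (B : ι → Finset V) (S : Finset (Finset ι))
    (W : Finset ι) (y : ι → V) : ι → Finset V :=
  fun i => if i ∈ W then {a ∈ B i | ∀ e ∈ S, i ∈ e → e.image (Function.update y i a) ∈ E} else B i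

/-- The point `y` hits the members of `S` outside `W`. -/
def HitsOff (E : Finset (Finset V)) (S : Finset (Finset ι)) (W : Finset ι) (y : ι → V) : Prop :=
  ∀ e ∈ S, Disjoint e W → e.image y ∈ E

theorem fiberBox_subset (E : Finset (Finset V)) (B : ι → Finset V) (S : Finset (Finset ι))
    (W : Finset ι) (y : ι → V) (i : ι) : fiberBox E B S W y i ⊆ B i := by
  unfold fiberBox
  split_ifs
  · exact Finset.filter_subset _ _
  · exact Subset.rfl

theorem sum_fiberBox_le (E : Finset (Finset V)) (B : ι → Finset V) (S T : Finset (Finset ι))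
    (W : Finset ι) (hS : ∀ e ∈ S, #(e ∩ W) ≤ 1) (hT : ∀ e ∈ T, e ⊆ W) :
    ∑ y ∈ Fintype.piFinset B with HitsOff E S W y, boxCount E (fiberBox E B S W y) T ≤
      #(Fintype.piFinset B) * boxCount E B (S ∪ T) := by
  unfold boxCount
  rw [← Finset.card_sigma, mul_comm, ← Finset.card_product]
  refine Finset.card_le_card_of_injOn
    (fun p => (W.piecewise p.2 p.1, W.piecewise p.1 p.2)) ?_ ?_
  · rintro ⟨y, u⟩ h
    simp only [Finset.coe_sigma, Set.mem_sigma_iff, Finset.mem_coe, Finset.mem_filter,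
      Fintype.mem_piFinset] at h
    obtain ⟨⟨hy, hoff⟩, hu, hits⟩ := h
    have huB : ∀ i, u i ∈ B i := fun i => fiberBox_subset E B S W y i (hu i)
    simp only [Finset.coe_product, Set.mem_prod, Finset.mem_coe, Finset.mem_filter,
      Fintype.mem_piFinset]
    refine ⟨⟨fun i => ?_, fun e he => ?_⟩, fun i => ?_⟩
    · by_cases hi : i ∈ W <;> simp [hi, hy i, huB i]
    · rcases Finset.mem_union.mp he with he | he
      · by_cases hd : Disjoint e W
        · have : e.image (W.piecewise u y) = e.image y := Finset.image_congr fun i hi =>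
            Finset.piecewise_eq_of_notMem _ _ _ (Finset.disjoint_left.mp hd hi)
          rw [this]
          exact hoff e he hd
        · obtain ⟨i, hie, hiW⟩ := Finset.not_disjoint_iff.mp hd
          have : e.image (W.piecewise u y) = e.image (Function.update y i (u i)) := by
            refine Finset.image_congr fun j hj => ?_
            by_cases hji : j = i
            · subst hji; simp [hiW]
            · have hjW : j ∉ W := fun hjW => hji (Finset.card_le_one.mp (hS e he) j
                (Finset.mem_inter.mpr ⟨hj, hjW⟩) i (Finset.mem_inter.mpr ⟨hie, hiW⟩))
              simp [hji, hjW]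
          rw [this]
          have := hu i
          rw [fiberBox, if_pos hiW, Finset.mem_filter] at this
          exact this.2 e he hie
      · have : e.image (W.piecewise u y) = e.image u := Finset.image_congr fun i hi =>
          Finset.piecewise_eq_of_mem _ _ _ (hT e he hi)
        rw [this]
        exact hits e he
    · by_cases hi : i ∈ W <;> simp [hi, hy i, huB i]
  · rintro ⟨y, u⟩ - ⟨y', u'⟩ - h
    simp only [Prod.mk.injEq] at h
    have h1 : y = y' := by
      funext i
      by_cases hi : i ∈ W
      · simpa [hi] using congrFun h.2 i
      · simpa [hi] using congrFun h.1 i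
    have h2 : u = u' := by
      funext i
      by_cases hi : i ∈ W
      · simpa [hi] using congrFun h.1 i
      · simpa [hi] using congrFun h.2 i
    rw [h1, h2]

theorem le_sum_fiberBox (E : Finset (Finset V)) (B : ι → Finset V) (S : Finset (Finset ι))
    (W : Finset ι) (hS : ∀ e ∈ S, #(e ∩ W) ≤ 1) :
    #(Fintype.piFinset B) * boxCount E B S ≤
      ∑ y ∈ Fintype.piFinset B with HitsOff E S W y, #(Fintype.piFinset (fiberBox E B S W y)) := by
  unfold boxCount
  rw [← Finset.card_sigma, mul_comm, ← Finset.card_product]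
  refine Finset.card_le_card_of_injOn
    (fun p => ⟨W.piecewise p.2 p.1, W.piecewise p.1 p.2⟩) ?_ ?_
  · rintro ⟨x, z⟩ h
    simp only [Finset.coe_product, Set.mem_prod, Finset.mem_coe, Finset.mem_filter,
      Fintype.mem_piFinset] at h
    obtain ⟨⟨hx, hits⟩, hz⟩ := h
    simp only [Finset.coe_sigma, Set.mem_sigma_iff, Finset.mem_coe, Finset.mem_filter,
      Fintype.mem_piFinset]
    refine ⟨⟨fun i => ?_, fun e he hd => ?_⟩, fun i => ?_⟩
    · by_cases hi : i ∈ W <;> simp [hi, hx i, hz i]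
    · have : e.image (W.piecewise z x) = e.image x := Finset.image_congr fun i hi =>
        Finset.piecewise_eq_of_notMem _ _ _ (Finset.disjoint_left.mp hd hi)
      rw [this]
      exact hits e he
    · unfold fiberBox
      by_cases hi : i ∈ W
      · rw [if_pos hi, Finset.mem_filter, Finset.piecewise_eq_of_mem _ _ _ hi]
        refine ⟨hx i, fun e he hie => ?_⟩
        have : e.image (Function.update (W.piecewise z x) i (x i)) = e.image x := by
          refine Finset.image_congr fun j hj => ?_
          by_cases hji : j = i
          · subst hji; simp
          · have hjW : j ∉ W := fun hjW => hji (Finset.card_le_one.mp (hS e he) j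
              (Finset.mem_inter.mpr ⟨hj, hjW⟩) i (Finset.mem_inter.mpr ⟨hie, hi⟩))
            simp [hji, hjW]
        rw [this]
        exact hits e he
      · rw [if_neg hi, Finset.piecewise_eq_of_notMem _ _ _ hi]
        exact hz i
  · rintro ⟨y, u⟩ - ⟨y', u'⟩ - h
    simp only [Sigma.mk.injEq, heq_eq_eq] at h
    have h1 : y = y' := by
      funext i
      by_cases hi : i ∈ W
      · simpa [hi] using congrFun h.2 i
      · simpa [hi] using congrFun h.1 i
    have h2 : u = u' := by
      funext i
      by_cases hi : i ∈ W
      · simpa [hi] using congrFun h.1 i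
      · simpa [hi] using congrFun h.2 i
    rw [h1, h2]

theorem boxVol_le_of_small_side {B D : ι → Finset V} (hDB : ∀ i, D i ⊆ B i) (r : ℕ) (hr : 0 < r)
    (i : ι) (hi : r * #(D i) < #(B i)) : boxVol D ≤ boxVol B / r := by
  have hr' : (0 : ℝ) < r := by exact_mod_cast hr
  rw [le_div_iff₀ hr']
  unfold boxVol
  rw [← Finset.mul_prod_erase _ _ (Finset.mem_univ i),
    ← Finset.mul_prod_erase univ (fun j => (#(B j) : ℝ)) (Finset.mem_univ i)]
  have h1 : ∏ x ∈ univ.erase i, (#(D x) : ℝ) ≤ ∏ x ∈ univ.erase i, (#(B x) : ℝ) :=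
    Finset.prod_le_prod (fun _ _ => by positivity) fun j _ => by
      exact_mod_cast Finset.card_le_card (hDB j)
  have h2 : (r : ℝ) * #(D i) ≤ #(B i) := by exact_mod_cast hi.le
  have h3 : 0 ≤ ∏ x ∈ univ.erase i, (#(D x) : ℝ) := Finset.prod_nonneg fun _ _ => by positivity
  calc _ = ((r : ℝ) * #(D i)) * ∏ x ∈ univ.erase i, (#(D x) : ℝ) := by ring
    _ ≤ _ := by gcongr

/-- A pattern supported on `W` can be glued to a pattern meeting `W` in single points. -/
theorem LowerRegular.glue {E : Finset (Finset V)} {B : ι → Finset V} {r : ℕ} {γ : ℝ}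
    (hreg : LowerRegular E B r γ) (hB : ∀ i, 0 < #(B i)) (hr : 0 < r) (hγ : 0 ≤ γ)
    (S T : Finset (Finset ι)) (W : Finset ι) (hS : ∀ e ∈ S, #(e ∩ W) ≤ 1)
    (hT : ∀ e ∈ T, e ⊆ W) (θ : ℝ) (hθ : 0 ≤ θ) (hθT : θ ≤ boxDens E B T - γ) :
    θ * boxDens E B S - 1 / r ≤ boxDens E B (S ∪ T) := by
  have hr' : (0 : ℝ) < r := by exact_mod_cast hr
  have hv := boxVol_pos hB
  have hθ1 : θ ≤ 1 := by linarith [boxDens_le_one E B T]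
  have hterm : ∀ y, θ * boxVol (fiberBox E B S W y) - boxVol B / r ≤
      boxCount E (fiberBox E B S W y) T := by
    intro y
    have hsub := fiberBox_subset E B S W y
    by_cases hside : ∀ i, #(B i) ≤ r * #(fiberBox E B S W y i)
    · have hpos : ∀ i, 0 < #(fiberBox E B S W y i) := fun i => by
        have h1 := hside i
        have h2 := hB i
        by_contra h0
        have h3 : #(fiberBox E B S W y i) = 0 := by omega
        rw [h3] at h1
        omega
      have h := hreg _ hsub hside T
      rw [← boxDens_mul_boxVol E hpos]
      have h2 : θ * boxVol (fiberBox E B S W y) ≤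
          boxDens E (fiberBox E B S W y) T * boxVol (fiberBox E B S W y) :=
        mul_le_mul_of_nonneg_right (by linarith) (boxVol_nonneg _)
      have : 0 ≤ boxVol B / r := by positivity
      linarith
    · push Not at hside
      obtain ⟨i, hi⟩ := hside
      have h := boxVol_le_of_small_side hsub r hr i hi
      have h2 : θ * boxVol (fiberBox E B S W y) ≤ 1 * boxVol (fiberBox E B S W y) :=
        mul_le_mul_of_nonneg_right hθ1 (boxVol_nonneg _)
      have h3 : (0 : ℝ) ≤ boxCount E (fiberBox E B S W y) T := by positivity
      linarith
  have h1 : ((∑ y ∈ Fintype.piFinset B with HitsOff E S W y,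
      boxCount E (fiberBox E B S W y) T : ℕ) : ℝ) ≤ boxVol B * boxCount E B (S ∪ T) := by
    rw [← card_piFinset_eq_boxVol]
    exact_mod_cast sum_fiberBox_le E B S T W hS hT
  have h2 : boxVol B * boxCount E B S ≤
      ∑ y ∈ Fintype.piFinset B with HitsOff E S W y, boxVol (fiberBox E B S W y) := by
    simp only [← card_piFinset_eq_boxVol]
    exact_mod_cast le_sum_fiberBox E B S W hS
  have h3 : ∑ y ∈ Fintype.piFinset B with HitsOff E S W y,
      (θ * boxVol (fiberBox E B S W y) - boxVol B / r) ≤ boxVol B * boxCount E B (S ∪ T) := by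
    refine le_trans ?_ h1
    push_cast
    exact Finset.sum_le_sum fun y _ => hterm y
  rw [Finset.sum_sub_distrib, ← Finset.mul_sum, Finset.sum_const, nsmul_eq_mul] at h3
  have h4 : (#{y ∈ Fintype.piFinset B | HitsOff E S W y} : ℝ) ≤ boxVol B := by
    rw [← card_piFinset_eq_boxVol]
    exact_mod_cast Finset.card_filter_le _ _
  have h5 : (#{y ∈ Fintype.piFinset B | HitsOff E S W y} : ℝ) * (boxVol B / r) ≤
      boxVol B * (boxVol B / r) := mul_le_mul_of_nonneg_right h4 (by positivity)
  have h6 := mul_le_mul_of_nonneg_left h2 hθ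
  have h7 : boxVol B * (θ * boxCount E B S - boxVol B / r) ≤ boxVol B * boxCount E B (S ∪ T) := by
    nlinarith
  have h8 := le_of_mul_le_mul_left h7 hv
  unfold boxDens
  rw [le_div_iff₀ hv, sub_mul, mul_assoc, div_mul_cancel₀ _ hv.ne']
  calc _ = θ * boxCount E B S - boxVol B / r := by ring
    _ ≤ _ := h8

/-- Resampling one coordinate. -/
theorem card_mul_card_filter_eq_sum_update (D : ι → Finset V) (w : ι) (p : (ι → V) → Prop)
    [DecidablePred p] :
    #(D w) * #{x ∈ Fintype.piFinset D | p x} =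
      ∑ x ∈ Fintype.piFinset D, #{v ∈ D w | p (Function.update x w v)} := by
  rw [← Finset.card_sigma, mul_comm, ← Finset.card_product]
  have hup : ∀ x ∈ Fintype.piFinset D, ∀ v ∈ D w, Function.update x w v ∈ Fintype.piFinset D := by
    intro x hx v hv
    rw [Fintype.mem_piFinset] at hx ⊢
    intro i
    by_cases hi : i = w
    · subst hi; simpa using hv
    · simpa [hi] using hx i
  refine Finset.card_nbij' (fun q => ⟨Function.update q.1 w q.2, q.1 w⟩)
    (fun q => (Function.update q.1 w q.2, q.1 w)) ?_ ?_ ?_ ?_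
  · rintro ⟨x, v⟩ h
    simp only [Finset.coe_product, Set.mem_prod, Finset.mem_coe, Finset.mem_filter] at h
    simp only [Finset.coe_sigma, Set.mem_sigma_iff, Finset.mem_coe, Finset.mem_filter]
    exact ⟨hup x h.1.1 v h.2, Fintype.mem_piFinset.mp h.1.1 w, by simpa using h.1.2⟩
  · rintro ⟨x, v⟩ h
    simp only [Finset.coe_sigma, Set.mem_sigma_iff, Finset.mem_coe, Finset.mem_filter] at h
    simp only [Finset.coe_product, Set.mem_prod, Finset.mem_coe, Finset.mem_filter]
    exact ⟨⟨hup x h.1 v h.2.1, h.2.2⟩, Fintype.mem_piFinset.mp h.1 w⟩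
  · rintro ⟨x, v⟩ _
    simp
  · rintro ⟨x, v⟩ _
    simp

end Mixing

section Books
open scoped Classical

/-- The book with spine `i, j` and pages `K`. -/
noncomputable def bookPattern {ι : Type} (i j : ι) (K : List ι) : Finset (Finset ι) :=
  (K.map fun k => ({i, j, k} : Finset ι)).toFinset

theorem hits_bookPattern {ι V : Type} {E : Finset (Finset V)} {i j : ι} {K : List ι} {x : ι → V} :
    Hits E (bookPattern i j K) x ↔ ∀ k ∈ K, ({x i, x j, x k} : Finset V) ∈ E := by
  simp [Hits, bookPattern, Finset.image_insert]

theorem sum_length_filter_eq {ι V : Type} (X : Finset (ι → V)) (q : ι → (ι → V) → Prop)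
    [∀ k x, Decidable (q k x)] (K : List ι) :
    ∑ x ∈ X, ((K.filter fun k => q k x).length : ℝ) =
      (K.map fun k => (#{x ∈ X | q k x} : ℝ)).sum := by
  induction K with
  | nil => simp
  | cons k K ih =>
    rw [List.map_cons, List.sum_cons, ← ih, Finset.card_filter]
    push_cast
    rw [← Finset.sum_add_distrib]
    refine Finset.sum_congr rfl fun x _ => ?_
    by_cases h : q k x
    · simp [h, add_comm]
    · simp [h]

variable {ι V : Type} [Fintype ι]

theorem exists_book {E : Finset (Finset V)} {B : ι → Finset V} (hB : ∀ i, 0 < #(B i))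
    {d : ℝ} (hd : 0 < d) {m : ℕ} (hm : 1 ≤ m) (i j : ι) (K₀ : List ι)
    (hR : 2 * m ≤ d * K₀.length) (h : ∀ k ∈ K₀, d ≤ boxDens E B {{i, j, k}}) :
    ∃ K, K.Sublist K₀ ∧ K.length = m ∧
      d / 2 ^ (K₀.length + 1) ≤ boxDens E B (bookPattern i j K) := by
  have hv := boxVol_pos hB
  set R := K₀.length with hRdef
  have hRpos : (0 : ℝ) < R := by
    have : (1 : ℝ) ≤ m := by exact_mod_cast hm
    by_contra h0
    have h1 : d * (R : ℝ) ≤ 0 := mul_nonpos_of_nonneg_of_nonpos hd.le (not_lt.mp h0)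
    linarith
  let q : ι → (ι → V) → Prop := fun k x => ({x i, x j, x k} : Finset V) ∈ E
  have hcount : ∀ k, boxCount E B {{i, j, k}} = #{x ∈ Fintype.piFinset B | q k x} := by
    intro k
    simp [boxCount, Hits, q, Finset.image_insert]
  have hsum : (R : ℝ) * (d * boxVol B) ≤
      ∑ x ∈ Fintype.piFinset B, ((K₀.filter fun k => q k x).length : ℝ) := by
    rw [sum_length_filter_eq]
    have := List.card_nsmul_le_sum
      (K₀.map fun k => (#{x ∈ Fintype.piFinset B | q k x} : ℝ)) (d * boxVol B) (by
        intro y hy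
        obtain ⟨k, hk, rfl⟩ := List.mem_map.mp hy
        have h2 := mul_le_mul_of_nonneg_right (h k hk) hv.le
        rw [boxDens_mul_boxVol E hB, hcount] at h2
        exact h2)
    simpa [nsmul_eq_mul] using this
  set X := (Fintype.piFinset B).filter fun x => m ≤ (K₀.filter fun k => q k x).length with hX
  have hup : ∑ x ∈ Fintype.piFinset B, ((K₀.filter fun k => q k x).length : ℝ) ≤
      m * boxVol B + R * #X := by
    calc _ ≤ ∑ x ∈ Fintype.piFinset B, ((m : ℝ) +
          if m ≤ (K₀.filter fun k => q k x).length then (R : ℝ) else 0) := by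
          refine Finset.sum_le_sum fun x _ => ?_
          split_ifs with hx
          · have : ((K₀.filter fun k => q k x).length : ℝ) ≤ R := by
              exact_mod_cast List.length_filter_le _ _
            have : (0 : ℝ) ≤ m := by positivity
            linarith
          · simp only [add_zero]
            exact_mod_cast (not_le.mp hx).le
      _ = _ := by
          rw [Finset.sum_add_distrib, Finset.sum_const, nsmul_eq_mul, card_piFinset_eq_boxVol,
            ← Finset.sum_filter, Finset.sum_const, nsmul_eq_mul]
          ring
  have hXcard : d / 2 * boxVol B ≤ #X := by
    have h1 : (R : ℝ) * (d / 2 * boxVol B) ≤ R * #X := by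
      have : (m : ℝ) * boxVol B ≤ d * R / 2 * boxVol B := by
        gcongr
        linarith
      nlinarith
    exact le_of_mul_le_mul_left h1 hRpos
  set 𝒦 := K₀.sublists.toFinset.filter fun K => K.length = m with h𝒦
  have hsub : X ⊆ 𝒦.biUnion fun K => {x ∈ Fintype.piFinset B | Hits E (bookPattern i j K) x} := by
    intro x hx
    rw [hX, Finset.mem_filter] at hx
    rw [Finset.mem_biUnion]
    refine ⟨(K₀.filter fun k => q k x).take m, ?_, ?_⟩
    · rw [h𝒦, Finset.mem_filter, List.mem_toFinset, List.mem_sublists]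
      exact ⟨(List.take_sublist _ _).trans List.filter_sublist, by simpa using hx.2⟩
    · rw [Finset.mem_filter, hits_bookPattern]
      refine ⟨hx.1, fun k hk => ?_⟩
      have := List.mem_of_mem_take hk
      rw [List.mem_filter] at this
      simpa using this.2
  have h𝒦card : (#𝒦 : ℝ) ≤ 2 ^ R := by
    have : #𝒦 ≤ 2 ^ R := calc
      #𝒦 ≤ #K₀.sublists.toFinset := Finset.card_filter_le _ _
      _ ≤ K₀.sublists.length := List.toFinset_card_le _
      _ = 2 ^ R := List.length_sublists _
    exact_mod_cast this
  have hXle : (#X : ℝ) ≤ ∑ K ∈ 𝒦, (boxCount E B (bookPattern i j K) : ℝ) := by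
    exact_mod_cast (Finset.card_le_card hsub).trans Finset.card_biUnion_le
  by_contra! hcon
  have hlt : ∀ K ∈ 𝒦, (boxCount E B (bookPattern i j K) : ℝ) < d / 2 ^ (R + 1) * boxVol B := by
    intro K hK
    rw [h𝒦, Finset.mem_filter, List.mem_toFinset, List.mem_sublists] at hK
    have := hcon K hK.1 hK.2
    rw [← boxDens_mul_boxVol E hB]
    exact mul_lt_mul_of_pos_right this hv
  have hne : 𝒦.Nonempty := by
    rw [Finset.nonempty_iff_ne_empty]
    intro h0
    rw [h0, Finset.sum_empty] at hXle
    have : 0 < d / 2 * boxVol B := by positivity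
    linarith
  have h1 := Finset.sum_lt_sum_of_nonempty hne hlt
  rw [Finset.sum_const, nsmul_eq_mul] at h1
  have h2 : (#𝒦 : ℝ) * (d / 2 ^ (R + 1) * boxVol B) ≤ 2 ^ R * (d / 2 ^ (R + 1) * boxVol B) := by
    gcongr
  have h3 : (2 : ℝ) ^ R * (d / 2 ^ (R + 1) * boxVol B) = d / 2 * boxVol B := by
    rw [pow_succ]; field_simp
  linarith

/-- The pair `a, b` has large degree into every cluster with index in `Ks`. -/
def PairDense (E : Finset (Finset V)) (B : ι → Finset V) (c : ℝ) (Ks : List ι) (a b : V) : Prop :=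
  ∀ w ∈ Ks, c * #(B w) ≤ #{v ∈ B w | ({a, b, v} : Finset V) ∈ E}

theorem LowerRegular.card_pairDense {E : Finset (Finset V)} {B : ι → Finset V} {r : ℕ} {γ : ℝ}
    (hreg : LowerRegular E B r γ) (hB : ∀ i, 0 < #(B i)) {c : ℝ} {Ks : List ι}
    (hc : 0 ≤ c) (hm : 1 ≤ Ks.length) (hγ : γ ≤ c / 2) {i j : ι} (hi : i ∉ Ks) (hj : j ∉ Ks)
    (hbook : c ≤ boxDens E B (bookPattern i j Ks)) {D : ι → Finset V} (hDB : ∀ i, D i ⊆ B i)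
    (hDK : ∀ w ∈ Ks, D w = B w) (hside : ∀ i, #(B i) ≤ r * #(D i)) :
    c / 4 * boxVol D ≤
      #{x ∈ Fintype.piFinset D | PairDense E B (c / (4 * Ks.length)) Ks (x i) (x j)} := by
  have hmpos : (0 : ℝ) < Ks.length := by exact_mod_cast hm
  have hDpos : ∀ i, 0 < #(D i) := fun i => by
    have h1 := hside i
    have h2 := hB i
    by_contra h0
    have h3 : #(D i) = 0 := by omega
    rw [h3] at h1
    omega
  set c' := c / (4 * Ks.length) with hc'
  have hX : c / 2 * boxVol D ≤ boxCount E D (bookPattern i j Ks) := by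
    rw [← boxDens_mul_boxVol E hDpos]
    have := hreg D hDB hside (bookPattern i j Ks)
    exact mul_le_mul_of_nonneg_right (by linarith) (boxVol_nonneg _)
  let Bad : ι → Finset (ι → V) := fun w => {x ∈ Fintype.piFinset D |
    ({x i, x j, x w} : Finset V) ∈ E ∧
      (#{v ∈ B w | ({x i, x j, v} : Finset V) ∈ E} : ℝ) < c' * #(B w)}
  have hBad : ∀ w ∈ Ks, (#(Bad w) : ℝ) ≤ c' * boxVol D := by
    intro w hw
    have hwi : i ≠ w := fun h => hi (h ▸ hw)
    have hwj : j ≠ w := fun h => hj (h ▸ hw)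
    have h1 := card_mul_card_filter_eq_sum_update D w (fun x => ({x i, x j, x w} : Finset V) ∈ E ∧
      (#{v ∈ B w | ({x i, x j, v} : Finset V) ∈ E} : ℝ) < c' * #(B w))
    have hpos : (0 : ℝ) < #(B w) := by exact_mod_cast hB w
    have h2 : (#(B w) : ℝ) * #(Bad w) ≤ ∑ x ∈ Fintype.piFinset D, c' * #(B w) := by
      rw [← hDK w hw] at *
      have h3 : (#(D w) : ℝ) * #(Bad w) = ∑ x ∈ Fintype.piFinset D,
          (#{v ∈ D w | ({x i, x j, v} : Finset V) ∈ E ∧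
            (#{v ∈ D w | ({x i, x j, v} : Finset V) ∈ E} : ℝ) < c' * #(D w)} : ℝ) := by
        simp only [Function.update_of_ne hwi, Function.update_of_ne hwj, Function.update_self] at h1
        simp only [Bad, ← hDK w hw]
        exact_mod_cast h1
      rw [h3]
      refine Finset.sum_le_sum fun x _ => ?_
      by_cases hx : (#{v ∈ D w | ({x i, x j, v} : Finset V) ∈ E} : ℝ) < c' * #(D w)
      · simp only [hx, and_true]
        exact hx.le
      · simp only [hx, and_false, Finset.filter_false, Finset.card_empty, Nat.cast_zero]
        positivity
    rw [Finset.sum_const, nsmul_eq_mul, card_piFinset_eq_boxVol] at h2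
    have h3 : (#(B w) : ℝ) * #(Bad w) ≤ #(B w) * (c' * boxVol D) := by linarith
    exact le_of_mul_le_mul_left h3 hpos
  have hcover : (Fintype.piFinset D).filter (fun x => Hits E (bookPattern i j Ks) x) ⊆
      (Fintype.piFinset D).filter (fun x => PairDense E B c' Ks (x i) (x j)) ∪
        Ks.toFinset.biUnion Bad := by
    intro x hx
    rw [Finset.mem_filter, hits_bookPattern] at hx
    by_cases hp : PairDense E B c' Ks (x i) (x j)
    · exact Finset.mem_union_left _ (Finset.mem_filter.mpr ⟨hx.1, hp⟩)
    · unfold PairDense at hp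
      push Not at hp
      obtain ⟨w, hw, hlt⟩ := hp
      refine Finset.mem_union_right _ (Finset.mem_biUnion.mpr ⟨w, by simpa using hw, ?_⟩)
      exact Finset.mem_filter.mpr ⟨hx.1, hx.2 w hw, hlt⟩
  have hle : (boxCount E D (bookPattern i j Ks) : ℝ) ≤
      #{x ∈ Fintype.piFinset D | PairDense E B c' Ks (x i) (x j)} +
        ∑ w ∈ Ks.toFinset, (#(Bad w) : ℝ) := by
    exact_mod_cast (Finset.card_le_card hcover).trans
      ((Finset.card_union_le _ _).trans (Nat.add_le_add_left Finset.card_biUnion_le _))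
  have hbadsum : ∑ w ∈ Ks.toFinset, (#(Bad w) : ℝ) ≤ c / 4 * boxVol D := by
    calc ∑ w ∈ Ks.toFinset, (#(Bad w) : ℝ) ≤ ∑ w ∈ Ks.toFinset, c' * boxVol D :=
          Finset.sum_le_sum fun w hw => hBad w (by simpa using hw)
      _ ≤ Ks.length * (c' * boxVol D) := by
          rw [Finset.sum_const, nsmul_eq_mul]
          have h1 : (#Ks.toFinset : ℝ) ≤ Ks.length := by exact_mod_cast List.toFinset_card_le Ks
          have h2 : 0 ≤ c' * boxVol D := mul_nonneg (by positivity) (boxVol_nonneg D)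
          exact mul_le_mul_of_nonneg_right h1 h2
      _ = c / 4 * boxVol D := by rw [hc']; field_simp
  linarith

end Books

section Cliques
open scoped Classical

variable {ι V : Type} [Fintype ι]

theorem card_bad_lt {B : ι → Finset V} {r : ℕ} {g : ℝ} (hg : 0 < g)
    {G : V → V → Prop} {Ks : List ι} {i j : ι} (hij : i ≠ j) (hiK : i ∉ Ks)
    (hB : ∀ i, 0 < #(B i))
    (hG : ∀ D : ι → Finset V, (∀ i, D i ⊆ B i) → (∀ w ∈ Ks, D w = B w) →
      (∀ i, #(B i) ≤ r * #(D i)) → g * boxVol D ≤ #{x ∈ Fintype.piFinset D | G (x i) (x j)})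
    {D : ι → Finset V} (hDB : ∀ i, D i ⊆ B i) (hDK : ∀ w ∈ Ks, D w = B w)
    (hside : ∀ i, #(B i) ≤ r * #(D i)) :
    r * #{a ∈ D i | (#{b ∈ D j | G a b} : ℝ) < g / 2 * #(D j)} < #(B i) := by
  by_contra! hle
  set bad := {a ∈ D i | (#{b ∈ D j | G a b} : ℝ) < g / 2 * #(D j)} with hbad
  set D' := Function.update D i bad with hD'
  have hD'i : D' i = bad := by simp [hD']
  have hD'k : ∀ k, k ≠ i → D' k = D k := fun k hk => by simp [hD', hk]
  have hside' : ∀ k, #(B k) ≤ r * #(D' k) := fun k => by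
    by_cases hk : k = i
    · subst hk; rw [hD'i]; exact hle
    · rw [hD'k k hk]; exact hside k
  have h1 := hG D' (fun k => by
      by_cases hk : k = i
      · subst hk; rw [hD'i]; exact (Finset.filter_subset _ _).trans (hDB k)
      · rw [hD'k k hk]; exact hDB k)
    (fun w hw => by rw [hD'k w (fun h => hiK (h ▸ hw))]; exact hDK w hw) hside'
  have hpos : ∀ k, 0 < #(D' k) := fun k => by
    have h1 := hside' k
    have h2 := hB k
    by_contra h0
    have h3 : #(D' k) = 0 := by omega
    rw [h3] at h1
    omega
  have h2 := card_mul_card_filter_eq_sum_update D' j (fun x => G (x i) (x j))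
  simp only [Function.update_of_ne hij, Function.update_self] at h2
  have hjpos : (0 : ℝ) < #(D' j) := by exact_mod_cast hpos j
  have h3 : (#(D' j) : ℝ) * #{x ∈ Fintype.piFinset D' | G (x i) (x j)} ≤
      ∑ x ∈ Fintype.piFinset D', g / 2 * #(D' j) := by
    have : (#(D' j) : ℝ) * #{x ∈ Fintype.piFinset D' | G (x i) (x j)} =
        ∑ x ∈ Fintype.piFinset D', (#{v ∈ D' j | G (x i) v} : ℝ) := by exact_mod_cast h2
    rw [this]
    refine Finset.sum_le_sum fun x hx => ?_
    have hxi := Fintype.mem_piFinset.mp hx i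
    rw [hD'i, hbad, Finset.mem_filter] at hxi
    rw [hD'k j hij.symm]
    exact hxi.2.le
  rw [Finset.sum_const, nsmul_eq_mul, card_piFinset_eq_boxVol] at h3
  have h4 : (#(D' j) : ℝ) * #{x ∈ Fintype.piFinset D' | G (x i) (x j)} ≤
      #(D' j) * (g / 2 * boxVol D') := by linarith
  have h5 := le_of_mul_le_mul_left h4 hjpos
  have h6 := mul_pos hg (boxVol_pos hpos)
  linarith

/-- Many points of a box are cliques of a relation that is dense on all large sub-boxes. -/
theorem card_clique {B : ι → Finset V} {s r N : ℕ} {g : ℝ} (hs : 0 < s) (hr : 0 < r)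
    (hN : 1 ≤ N) (hBs : ∀ i, #(B i) = s) (hg : 0 < g) (hg1 : g ≤ 1) {G : V → V → Prop}
    {Ks : List ι} :
    ∀ I : List ι, I.Nodup → (∀ w ∈ Ks, w ∉ I) → I.length ≤ N →
    (∀ i j, [i, j].Sublist I → ∀ D : ι → Finset V, (∀ i, D i ⊆ B i) → (∀ w ∈ Ks, D w = B w) →
      (∀ i, #(B i) ≤ r * #(D i)) → g * boxVol D ≤ #{x ∈ Fintype.piFinset D | G (x i) (x j)}) →
    ∀ τ : ℝ, 0 < τ → 2 * N * s / r ≤ (g / 2) ^ I.length * τ →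
    ∀ D : ι → Finset V, (∀ i, D i ⊆ B i) → (∀ w ∈ Ks, D w = B w) → (∀ i, τ ≤ #(D i)) →
    (1 / 2 : ℝ) ^ I.length * ((g / 2) ^ I.length * τ) ^ Fintype.card ι ≤
      #{x ∈ Fintype.piFinset D | I.Pairwise fun i j => G (x i) (x j)} := by
  have hB : ∀ i, 0 < #(B i) := fun i => by rw [hBs]; exact hs
  have hr' : (0 : ℝ) < r := by exact_mod_cast hr
  have hs' : (0 : ℝ) < s := by exact_mod_cast hs
  have hN' : (1 : ℝ) ≤ N := by exact_mod_cast hN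
  intro I
  induction I with
  | nil =>
    intro _ _ _ _ τ hτ _ D _ _ hD
    simp only [List.length_nil, pow_zero, one_mul, List.Pairwise.nil, Finset.filter_true,
      card_piFinset_eq_boxVol]
    calc τ ^ Fintype.card ι = ∏ _i : ι, τ := by simp
      _ ≤ boxVol D := Finset.prod_le_prod (fun _ _ => hτ.le) fun i _ => hD i
  | cons i I ih =>
    intro hnd hdis hlen hG τ hτ hτr D hDB hDK hD
    rw [List.nodup_cons] at hnd
    have hpow1 : (g / 2) ^ (i :: I).length ≤ 1 := pow_le_one₀ (by positivity) (by linarith)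
    have hτ2 : 2 * N * s / r ≤ τ := hτr.trans (by
      calc _ ≤ 1 * τ := mul_le_mul_of_nonneg_right hpow1 hτ.le
        _ = τ := one_mul τ)
    have hside : ∀ k, #(B k) ≤ r * #(D k) := fun k => by
      have h1 : (s : ℝ) ≤ r * #(D k) := by
        have h2 := hτ2.trans (hD k)
        rw [div_le_iff₀ hr'] at h2
        have h3 : (s : ℝ) ≤ 2 * N * s := by nlinarith
        linarith
      rw [hBs]
      exact_mod_cast h1
    let bad : ι → Finset V := fun j => {a ∈ D i | (#{b ∈ D j | G a b} : ℝ) < g / 2 * #(D j)}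
    have hiK : i ∉ Ks := fun h => hdis i h (by simp)
    have hbad : ∀ j ∈ I, (#(bad j) : ℝ) ≤ s / r := by
      intro j hj
      have hij : i ≠ j := by
        rintro rfl
        exact hnd.1 hj
      have hlt := card_bad_lt hg hij hiK hB
        (hG i j ((List.singleton_sublist.mpr hj).cons_cons i)) hDB hDK hside
      rw [hBs] at hlt
      rw [le_div_iff₀ hr', mul_comm]
      exact_mod_cast hlt.le
    set good := D i \ I.toFinset.biUnion bad with hgood
    have hgoodcard : (#(D i) : ℝ) / 2 ≤ #good := by
      have h1 : (#(I.toFinset.biUnion bad) : ℝ) ≤ N * (s / r) := by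
        calc (#(I.toFinset.biUnion bad) : ℝ) ≤ ∑ j ∈ I.toFinset, (#(bad j) : ℝ) := by
              exact_mod_cast Finset.card_biUnion_le
          _ ≤ ∑ j ∈ I.toFinset, (s : ℝ) / r :=
              Finset.sum_le_sum fun j hj => hbad j (by simpa using hj)
          _ ≤ N * (s / r) := by
              rw [Finset.sum_const, nsmul_eq_mul]
              gcongr
              have := List.toFinset_card_le I
              simp only [List.length_cons] at hlen
              omega
      have h2 : (#(D i) : ℝ) ≤ #(I.toFinset.biUnion bad) + #good := by
        have : #(D i) ≤ #(I.toFinset.biUnion bad) + #good := by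
          have := Finset.le_card_sdiff (I.toFinset.biUnion bad) (D i)
          rw [← hgood] at this
          omega
        exact_mod_cast this
      have h3 := hτ2.trans (hD i)
      have h4 : 2 * N * s / r = 2 * (N * ((s : ℝ) / r)) := by ring
      linarith
    let Da : V → ι → Finset V := fun a j => if j ∈ I then {b ∈ D j | G a b} else D j
    have hDaD : ∀ a j, Da a j ⊆ D j := fun a j => by
      simp only [Da]
      split_ifs
      · exact Finset.filter_subset _ _
      · exact Subset.rfl
    set low := (1 / 2 : ℝ) ^ I.length * ((g / 2) ^ I.length * (g / 2 * τ)) ^ Fintype.card ι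
      with hlow
    have hDa : ∀ a ∈ good, low ≤
        #{x ∈ Fintype.piFinset (Da a) | I.Pairwise fun i j => G (x i) (x j)} := by
      intro a ha
      rw [hgood, Finset.mem_sdiff, Finset.mem_biUnion] at ha
      refine ih hnd.2 (fun w hw h => hdis w hw (by simp [h])) (by simp at hlen; omega)
        (fun i' j' h => hG i' j' (h.cons i)) (g / 2 * τ) (by positivity) ?_ (Da a)
        (fun k => (hDaD a k).trans (hDB k)) (fun w hw => ?_) (fun j => ?_)
      · rw [List.length_cons, pow_succ] at hτr
        rw [← mul_assoc]; exact hτr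
      · have : w ∉ I := fun h => hdis w hw (by simp [h])
        simp only [Da, this, if_false]
        exact hDK w hw
      · by_cases hj : j ∈ I
        · simp only [Da, hj, if_true]
          have hnb : a ∉ bad j := fun h => ha.2 ⟨j, by simpa using hj, h⟩
          simp only [bad, Finset.mem_filter, not_and, not_lt] at hnb
          refine le_trans ?_ (hnb ha.1)
          exact mul_le_mul_of_nonneg_left (hD j) (by positivity)
        · simp only [Da, hj, if_false]
          have := hD j
          nlinarith
    have hDipos : (0 : ℝ) < #(D i) := hτ.trans_le (hD i)
    have hswap := card_mul_card_filter_eq_sum_update D i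
      (fun x => (i :: I).Pairwise fun i j => G (x i) (x j))
    have hswap2 : #(D i) * #{x ∈ Fintype.piFinset D | (i :: I).Pairwise fun i j => G (x i) (x j)} =
        ∑ v ∈ D i, #{x ∈ Fintype.piFinset D | (i :: I).Pairwise fun j k =>
          G (Function.update x i v j) (Function.update x i v k)} := by
      rw [hswap]
      simp only [Finset.card_filter]
      rw [Finset.sum_comm]
    have hfinal : (#(D i) : ℝ) / 2 * low ≤
        #(D i) * #{x ∈ Fintype.piFinset D | (i :: I).Pairwise fun i j => G (x i) (x j)} := by
      have hlow0 : 0 ≤ low := by positivity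
      calc (#(D i) : ℝ) / 2 * low ≤ #good * low := by gcongr
        _ = ∑ _v ∈ good, low := by rw [Finset.sum_const, nsmul_eq_mul]
        _ ≤ ∑ v ∈ good, (#{x ∈ Fintype.piFinset (Da v) |
              I.Pairwise fun i j => G (x i) (x j)} : ℝ) := Finset.sum_le_sum hDa
        _ ≤ ∑ v ∈ good, (#{x ∈ Fintype.piFinset D | (i :: I).Pairwise fun j k =>
              G (Function.update x i v j) (Function.update x i v k)} : ℝ) := by
            refine Finset.sum_le_sum fun v _ => ?_
            norm_cast
            refine Finset.card_le_card fun x hx => ?_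
            rw [Finset.mem_filter, Fintype.mem_piFinset] at hx ⊢
            refine ⟨fun k => hDaD v k (hx.1 k), ?_⟩
            rw [List.pairwise_cons]
            have hne : ∀ j ∈ I, j ≠ i := fun j hj h => hnd.1 (h ▸ hj)
            refine ⟨fun j hj => ?_, hx.2.imp_of_mem fun {j k} hj hk h => ?_⟩
            · have := hx.1 j
              simp only [Da, hj, if_true, Finset.mem_filter] at this
              simpa [hne j hj] using this.2
            · simpa [hne j hj, hne k hk] using h
        _ ≤ ∑ v ∈ D i, (#{x ∈ Fintype.piFinset D | (i :: I).Pairwise fun j k =>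
              G (Function.update x i v j) (Function.update x i v k)} : ℝ) :=
            Finset.sum_le_sum_of_subset_of_nonneg Finset.sdiff_subset
              fun _ _ _ => by positivity
        _ = _ := by exact_mod_cast hswap2.symm
    have hfinal2 : (#(D i) : ℝ) * (low / 2) ≤
        #(D i) * #{x ∈ Fintype.piFinset D | (i :: I).Pairwise fun i j => G (x i) (x j)} := by
      linarith
    refine le_trans (le_of_eq ?_) (le_of_mul_le_mul_left hfinal2 hDipos)
    rw [hlow, List.length_cons, pow_succ, pow_succ]
    ring

/-- Every pattern of triples with two points in `J` and one in `Ks` whose links have no monotone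
path has density at least `c`. -/
def GoodPair (E : Finset (Finset V)) (B : ι → Finset V) (c : ℝ) (J Ks : List ι) : Prop :=
  ∀ T : Finset (Finset ι),
    (∀ e ∈ T, ∃ x y w, [x, y].Sublist J ∧ w ∈ Ks ∧ e = {x, y, w}) →
    (∀ w ∈ Ks, ∀ x y z, [x, y].Sublist J → [y, z].Sublist J →
      {x, y, w} ∈ T → {y, z, w} ∈ T → False) →
    c ≤ boxDens E B T

theorem exists_goodPair {E : Finset (Finset V)} {B : ι → Finset V} {s m N : ℕ} {ε θ c : ℝ}
    (hs : 0 < s) (hBs : ∀ i, #(B i) = s) (hθ : 0 < θ) (hθ1 : θ ≤ 1) (hc : 0 < c)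
    {I Ks : List ι} (hdis : ∀ w ∈ Ks, w ∉ I) (hIN : I.length = N)
    (hlab : ∀ (R : ι → ι → ι → V → Prop),
      (∀ w ∈ Ks, ∀ i j, [i, j].Sublist I → ε * #(B w) ≤ #{v ∈ B w | R w i j v}) →
      ∃ J : List ι, J.Sublist I ∧ J.length = m ∧ ∀ w ∈ Ks, ∀ lab : ι → Bool,
        θ * #(B w) ≤ #{v ∈ B w | J.Pairwise fun x y => lab x = true → lab y = false → R w x y v})
    (hcl : c * boxVol B ≤
      #{x ∈ Fintype.piFinset B | I.Pairwise fun i j => PairDense E B ε Ks (x i) (x j)}) :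
    ∃ J : List ι, J.Sublist I ∧ J.length = m ∧
      GoodPair E B (c / 2 ^ N * θ ^ Fintype.card ι) J Ks := by
  have hB : ∀ i, 0 < #(B i) := fun i => by rw [hBs]; exact hs
  have hv := boxVol_pos hB
  set X := {x ∈ Fintype.piFinset B | I.Pairwise fun i j => PairDense E B ε Ks (x i) (x j)} with hX
  let good : List ι → (ι → V) → Prop := fun J x => ∀ w ∈ Ks, ∀ lab : ι → Bool,
    θ * #(B w) ≤ (#{v ∈ B w | J.Pairwise fun i j =>
      lab i = true → lab j = false → ({x i, x j, v} : Finset V) ∈ E} : ℝ)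
  have hgood : ∀ x ∈ X, ∃ J : List ι, J.Sublist I ∧ J.length = m ∧ good J x := by
    intro x hx
    rw [hX, Finset.mem_filter] at hx
    obtain ⟨J, h1, h2, h3⟩ := hlab (fun _ i j v => ({x i, x j, v} : Finset V) ∈ E) (by
      intro w hw i j hij
      have := List.pairwise_iff_forall_sublist.mp hx.2 hij
      convert this w hw)
    exact ⟨J, h1, h2, fun w hw lab => by convert h3 w hw lab⟩
  set 𝒥 := I.sublists.toFinset.filter fun J => J.length = m with h𝒥
  have hsub : X ⊆ 𝒥.biUnion fun J => {x ∈ Fintype.piFinset B | good J x} := by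
    intro x hx
    obtain ⟨J, h1, h2, h3⟩ := hgood x hx
    rw [Finset.mem_biUnion]
    refine ⟨J, ?_, ?_⟩
    · rw [h𝒥, Finset.mem_filter, List.mem_toFinset, List.mem_sublists]
      exact ⟨h1, h2⟩
    · exact Finset.mem_filter.mpr ⟨(Finset.mem_filter.mp hx).1, h3⟩
  have h𝒥card : (#𝒥 : ℝ) ≤ 2 ^ N := by
    have : #𝒥 ≤ 2 ^ N := calc
      #𝒥 ≤ #I.sublists.toFinset := Finset.card_filter_le _ _
      _ ≤ I.sublists.length := List.toFinset_card_le _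
      _ = 2 ^ N := by rw [List.length_sublists, hIN]
    exact_mod_cast this
  have hXle : c * boxVol B ≤ ∑ J ∈ 𝒥, (#{x ∈ Fintype.piFinset B | good J x} : ℝ) := by
    refine hcl.trans ?_
    exact_mod_cast (Finset.card_le_card hsub).trans Finset.card_biUnion_le
  obtain ⟨J, hJ𝒥, hJ⟩ : ∃ J ∈ 𝒥, c / 2 ^ N * boxVol B ≤ #{x ∈ Fintype.piFinset B | good J x} := by
    apply Finset.exists_le_of_sum_le
    · rw [Finset.nonempty_iff_ne_empty]
      intro h0
      rw [h0, Finset.sum_empty] at hXle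
      have : 0 < c * boxVol B := by positivity
      linarith
    · refine le_trans ?_ hXle
      rw [Finset.sum_const, nsmul_eq_mul]
      calc (#𝒥 : ℝ) * (c / 2 ^ N * boxVol B) ≤ 2 ^ N * (c / 2 ^ N * boxVol B) := by gcongr
        _ = c * boxVol B := by field_simp
  rw [h𝒥, Finset.mem_filter, List.mem_toFinset, List.mem_sublists] at hJ𝒥
  refine ⟨J, hJ𝒥.1, hJ𝒥.2, fun T hT hmono => ?_⟩
  have hJK : ∀ w ∈ Ks, w ∉ J := fun w hw h => hdis w hw (hJ𝒥.1.subset h)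
  have hTW : ∀ e ∈ T, #(e ∩ Ks.toFinset) ≤ 1 := by
    intro e he
    obtain ⟨x, y, w, hxy, hw, rfl⟩ := hT e he
    rw [Finset.card_le_one]
    intro a ha b hb
    simp only [Finset.mem_inter, Finset.mem_insert, Finset.mem_singleton,
      List.mem_toFinset] at ha hb
    have hx : x ∈ J := hxy.subset (by simp)
    have hy : y ∈ J := hxy.subset (by simp)
    have haw : a = w := by
      rcases ha.1 with rfl | rfl | rfl
      · exact absurd hx (hJK _ ha.2)
      · exact absurd hy (hJK _ ha.2)
      · rfl
    have hbw : b = w := by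
      rcases hb.1 with rfl | rfl | rfl
      · exact absurd hx (hJK _ hb.2)
      · exact absurd hy (hJK _ hb.2)
      · rfl
    rw [haw, hbw]
  have hmix := sum_fiberBox_le E B T ∅ Ks.toFinset hTW (by simp)
  have hempty : ∀ D : ι → Finset V, (boxCount E D ∅ : ℝ) = boxVol D := by
    intro D
    simp [boxCount, Hits, ← card_piFinset_eq_boxVol]
  have hmix' : ∑ y ∈ Fintype.piFinset B with HitsOff E T Ks.toFinset y,
      boxVol (fiberBox E B T Ks.toFinset y) ≤ boxVol B * boxCount E B T := by
    simp only [← hempty (fiberBox E B T Ks.toFinset _)]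
    rw [← card_piFinset_eq_boxVol]
    rw [Finset.union_empty] at hmix
    exact_mod_cast hmix
  have hfib : ∀ y, good J y → θ ^ Fintype.card ι * boxVol B ≤
      boxVol (fiberBox E B T Ks.toFinset y) := by
    intro y hy
    unfold boxVol
    rw [← Finset.card_univ, ← Finset.prod_const, ← Finset.prod_mul_distrib]
    refine Finset.prod_le_prod (fun i _ => by positivity) fun w _ => ?_
    by_cases hw : w ∈ Ks
    · have hw' : w ∈ Ks.toFinset := by simpa using hw
      refine (hy w hw fun x => decide (∃ z, [x, z].Sublist J ∧ ({x, z, w} : Finset ι) ∈ T)).trans ?_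
      norm_cast
      refine Finset.card_le_card fun v hv => ?_
      simp only [fiberBox, hw', if_true, Finset.mem_filter] at hv ⊢
      refine ⟨hv.1, fun e he hwe => ?_⟩
      obtain ⟨x, z, w', hxz, hw1, rfl⟩ := hT e he
      have hx : x ∈ J := hxz.subset (by simp)
      have hz : z ∈ J := hxz.subset (by simp)
      have hxw : x ≠ w := fun h => hJK w hw (h ▸ hx)
      have hzw : z ≠ w := fun h => hJK w hw (h ▸ hz)
      have hww : w' = w := by
        simp only [Finset.mem_insert, Finset.mem_singleton] at hwe
        rcases hwe with h | h | h
        · exact absurd h.symm hxw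
        · exact absurd h.symm hzw
        · exact h.symm
      subst hww
      have := List.pairwise_iff_forall_sublist.mp hv.2 hxz (by simpa using ⟨z, hxz, he⟩) (by
        simp only [decide_eq_false_iff_not]
        rintro ⟨z', hzz, hT'⟩
        exact hmono w' hw x z z' hxz hzz he hT')
      simpa [Finset.image_insert, hxw, hzw] using this
    · have hw' : w ∉ Ks.toFinset := by simpa using hw
      simp only [fiberBox, hw', if_false]
      have : (0 : ℝ) ≤ #(B w) := by positivity
      nlinarith
  have hoff : ∀ y, HitsOff E T Ks.toFinset y := by
    intro y e he hd
    obtain ⟨x, z, w, hxz, hw, rfl⟩ := hT e he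
    exact (Finset.disjoint_left.mp hd (show w ∈ ({x, z, w} : Finset ι) by simp)
      (by simpa using hw)).elim
  have hlow : c / 2 ^ N * boxVol B * (θ ^ Fintype.card ι * boxVol B) ≤
      boxVol B * boxCount E B T := by
    refine le_trans ?_ hmix'
    calc _ ≤ (#{x ∈ Fintype.piFinset B | good J x} : ℝ) * (θ ^ Fintype.card ι * boxVol B) := by
          gcongr
      _ = ∑ _y ∈ Fintype.piFinset B with good J _y, θ ^ Fintype.card ι * boxVol B := by
          rw [Finset.sum_const, nsmul_eq_mul]
      _ ≤ ∑ y ∈ Fintype.piFinset B with good J y, boxVol (fiberBox E B T Ks.toFinset y) :=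
          Finset.sum_le_sum fun y hy => hfib y (Finset.mem_filter.mp hy).2
      _ ≤ _ := by
          refine Finset.sum_le_sum_of_subset_of_nonneg (fun y hy => ?_)
            fun _ _ _ => boxVol_nonneg _
          exact Finset.mem_filter.mpr ⟨(Finset.mem_filter.mp hy).1, hoff y⟩
  have hlow2 : boxVol B * (c / 2 ^ N * θ ^ Fintype.card ι * boxVol B) ≤
      boxVol B * boxCount E B T := by linarith
  rw [boxDens, le_div_iff₀ hv]
  exact le_of_mul_le_mul_left hlow2 hv

end Cliques

section LocalDensity
open scoped Classical

theorem card_mul_card_filter_eq_sum {ι V : Type} [Fintype ι] (D : ι → Finset V) (w : ι)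
    (q : V → (ι → V) → Prop) (hq : ∀ a b x, q a (Function.update x w b) ↔ q a x) :
    #(D w) * #{x ∈ Fintype.piFinset D | q (x w) x} =
      ∑ a ∈ D w, #{x ∈ Fintype.piFinset D | q a x} := by
  rw [card_mul_card_filter_eq_sum_update D w fun x => q (x w) x]
  simp only [Function.update_self, hq, Finset.card_filter]
  rw [Finset.sum_comm]

theorem boxCount_triple {ι V : Type} [Fintype ι] (E : Finset (Finset V)) (D : ι → Finset V)
    {i j k : ι} (hij : i ≠ j) (hik : i ≠ k) (hjk : j ≠ k) :
    #(D i) * (#(D j) * (#(D k) * boxCount E D {{i, j, k}})) =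
      (∏ l, #(D l)) * #{t ∈ D i ×ˢ D j ×ˢ D k | ({t.1, t.2.1, t.2.2} : Finset V) ∈ E} := by
  have h0 : boxCount E D {{i, j, k}} =
      #{x ∈ Fintype.piFinset D | ({x i, x j, x k} : Finset V) ∈ E} := by
    simp [boxCount, Hits]
  have h1 := card_mul_card_filter_eq_sum D i (fun a x => ({a, x j, x k} : Finset V) ∈ E)
    (fun a b x => by simp [hij.symm, hik.symm])
  have h2 : ∀ a, _ := fun a => card_mul_card_filter_eq_sum D j
    (fun b x => ({a, b, x k} : Finset V) ∈ E) (fun _ _ x => by simp [hjk.symm])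
  have h3 : ∀ a b, _ := fun a b => card_mul_card_filter_eq_sum D k
    (fun c _ => ({a, b, c} : Finset V) ∈ E) (fun _ _ x => Iff.rfl)
  have h4 : #(D i) * (#(D j) * (#(D k) * boxCount E D {{i, j, k}})) =
      #(D k) * (#(D j) * (#(D i) * boxCount E D {{i, j, k}})) := by ring
  have h1' : #(D i) * #{x ∈ Fintype.piFinset D | ({x i, x j, x k} : Finset V) ∈ E} =
      ∑ a ∈ D i, #{x ∈ Fintype.piFinset D | ({a, x j, x k} : Finset V) ∈ E} := by
    convert h1
  have h2' : ∀ a, #(D j) * #{x ∈ Fintype.piFinset D | ({a, x j, x k} : Finset V) ∈ E} =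
      ∑ b ∈ D j, #{x ∈ Fintype.piFinset D | ({a, b, x k} : Finset V) ∈ E} := fun a => by
    convert h2 a
  have h3' : ∀ a b, #(D k) * #{x ∈ Fintype.piFinset D | ({a, b, x k} : Finset V) ∈ E} =
      ∑ c ∈ D k, #{x ∈ Fintype.piFinset D | ({a, b, c} : Finset V) ∈ E} := fun a b => by
    convert h3 a b
  rw [h4, h0, h1', Finset.mul_sum, Finset.mul_sum]
  simp only [h2', Finset.mul_sum, h3']
  simp only [Finset.card_filter, Finset.sum_product, Finset.mul_sum, Finset.sum_const,
    Fintype.card_piFinset, smul_eq_mul]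

theorem cube_div_le_choose_three {N : ℕ} (hN : 3 ≤ N) : (N : ℝ) ^ 3 / 27 ≤ (N.choose 3 : ℝ) := by
  have h6 : ∀ N : ℕ, (N.choose 3 : ℝ) = N * (N - 1) * (N - 2) / 6 := by
    intro N
    induction N with
    | zero => simp
    | succ N ih =>
      rw [Nat.choose_succ_succ]
      push_cast
      rw [ih, Nat.cast_choose_two]
      ring
  have hN' : (3 : ℝ) ≤ N := by exact_mod_cast hN
  rw [h6]
  generalize (N : ℝ) = x at *
  have h1 : 0 ≤ x * (x - 3) := mul_nonneg (by linarith) (by linarith)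
  nlinarith

/-- In a uniformly dense 3-graph some triple of any long list of equal clusters is dense. -/
theorem exists_dense_triple {ι V : Type} [Fintype ι] {s : ℕ} {E : Finset (Finset V)}
    (hE : ∀ e ∈ E, #e = 3) {d η : ℝ} (hd : 0 < d)
    (hH : ∀ U : Finset V, d * ((#U).choose 3 : ℝ) - η ≤ #(E.filter fun e => e ⊆ U))
    {B : ι → Finset V} (hdis : ∀ i j, i ≠ j → Disjoint (B i) (B j)) (hs : 0 < s)
    (hBs : ∀ i, #(B i) = s) {A : List ι} (hA : A.Nodup) (h3 : 3 ≤ A.length)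
    (hM : 324 ≤ d * A.length) (hη : η ≤ d / 108 * (A.length * s) ^ 3) :
    ∃ i j k, [i, j, k].Sublist A ∧ d / 108 ≤ boxDens E B {{i, j, k}} := by
  have hB : ∀ i, 0 < #(B i) := fun i => by rw [hBs]; exact hs
  have hcount : ∀ i j k, i ≠ j → i ≠ k → j ≠ k →
      (#{t ∈ B i ×ˢ B j ×ˢ B k | ({t.1, t.2.1, t.2.2} : Finset (V)) ∈ E} : ℝ) =
        boxDens E B {{i, j, k}} * s ^ 3 := by
    intro i j k hij hik hjk
    have h1 := boxCount_triple E B hij hik hjk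
    simp only [hBs] at h1
    have h2 := boxDens_mul_boxVol E hB {{i, j, k}}
    have h3 : (s : ℝ) * (s * (s * boxCount E B {{i, j, k}})) = boxVol B *
        #{t ∈ B i ×ˢ B j ×ˢ B k | ({t.1, t.2.1, t.2.2} : Finset (V)) ∈ E} := by
      have : boxVol B = ((∏ _l : ι, s : ℕ) : ℝ) := by simp [boxVol, hBs]
      rw [this]
      exact_mod_cast h1
    have hv := boxVol_pos hB
    apply mul_left_cancel₀ hv.ne'
    rw [← h3, ← h2]
    ring
  by_contra! hno
  set M := A.length with hMdef
  set I := A.toFinset with hI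
  have hIM : #I = M := List.toFinset_card_of_nodup hA
  have hlt : ∀ i ∈ I, ∀ j ∈ I, ∀ k ∈ I, i ≠ j → i ≠ k → j ≠ k →
      boxDens E B {{i, j, k}} ≤ d / 108 := by
    intro i hi j hj k hk hij hik hjk
    have hnd : ([i, j, k] : List _).Nodup := by simp [hij, hik, hjk]
    have hsub : ([i, j, k] : List _) ⊆ A := by
      intro x hx
      simp only [List.mem_cons, List.not_mem_nil, or_false] at hx
      rcases hx with rfl | rfl | rfl
      · simpa [hI] using hi
      · simpa [hI] using hj
      · simpa [hI] using hk
    obtain ⟨l, hl, hlA⟩ := List.subperm_of_subset hnd hsub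
    obtain ⟨a, b, c, rfl⟩ := List.length_eq_three.mp (hl.length_eq.trans rfl)
    have : ({a, b, c} : Finset (ι)) = {i, j, k} := by
      ext x
      have := hl.mem_iff (a := x)
      simpa using this
    rw [← this]
    exact (hno a b c hlA).le
  set U := I.biUnion B with hU
  have hUcard : #U = M * s := by
    rw [hU, Finset.card_biUnion fun i _ j _ h => hdis i j h]
    simp [hBs, hIM]
  let tri : ι × ι × ι → Finset (V × V × V) := fun p =>
    {t ∈ B p.1 ×ˢ B p.2.1 ×ˢ B p.2.2 | ({t.1, t.2.1, t.2.2} : Finset (V)) ∈ E}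
  have hcover : E.filter (fun e => e ⊆ U) ⊆
      ((I ×ˢ I ×ˢ I).biUnion tri).image fun t => {t.1, t.2.1, t.2.2} := by
    intro e he
    rw [Finset.mem_filter] at he
    obtain ⟨a, b, c, -, -, -, rfl⟩ := Finset.card_eq_three.mp (hE e he.1)
    have hmem : ∀ x ∈ ({a, b, c} : Finset (V)), ∃ i ∈ I, x ∈ B i := fun x hx => by
      simpa [hU] using he.2 hx
    obtain ⟨i, hi, hai⟩ := hmem a (by simp)
    obtain ⟨j, hj, hbj⟩ := hmem b (by simp)
    obtain ⟨k, hk, hck⟩ := hmem c (by simp)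
    refine Finset.mem_image.mpr ⟨(a, b, c), Finset.mem_biUnion.mpr ⟨(i, j, k), ?_, ?_⟩, rfl⟩
    · simp [hi, hj, hk]
    · simp only [tri, Finset.mem_filter, Finset.mem_product]
      exact ⟨⟨hai, hbj, hck⟩, he.1⟩
  have hedges : (#(E.filter fun e => e ⊆ U) : ℝ) ≤
      ∑ p ∈ I ×ˢ I ×ˢ I, (#(tri p) : ℝ) := by
    have := ((Finset.card_le_card hcover).trans Finset.card_image_le).trans Finset.card_biUnion_le
    exact_mod_cast this
  have hs0 : (0 : ℝ) < s := by exact_mod_cast hs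
  let pen : Prop → ℝ := fun q => if q then (s : ℝ) ^ 3 else 0
  have htri : ∀ p ∈ I ×ˢ I ×ˢ I, (#(tri p) : ℝ) ≤ d / 108 * s ^ 3 +
      pen (p.1 = p.2.1) + pen (p.1 = p.2.2) + pen (p.2.1 = p.2.2) := by
    rintro ⟨i, j, k⟩ hp
    simp only [Finset.mem_product] at hp
    have hpen : ∀ q, 0 ≤ pen q := fun q => by
      simp only [pen]
      split_ifs <;> positivity
    have htriv : (#(tri (i, j, k)) : ℝ) ≤ s ^ 3 := by
      have : #(tri (i, j, k)) ≤ s ^ 3 := by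
        refine (Finset.card_filter_le _ _).trans (le_of_eq ?_)
        simp only [Finset.card_product, hBs]
        ring
      exact_mod_cast this
    have hd3 : 0 ≤ d / 108 * (s : ℝ) ^ 3 := by positivity
    have p1 := hpen (i = j)
    have p2 := hpen (i = k)
    have p3 := hpen (j = k)
    by_cases hij : i = j
    · have : pen (i = j) = s ^ 3 := if_pos hij
      simp only; linarith
    by_cases hik : i = k
    · have : pen (i = k) = s ^ 3 := if_pos hik
      simp only; linarith
    by_cases hjk : j = k
    · have : pen (j = k) = s ^ 3 := if_pos hjk
      simp only; linarith
    have h1 := hcount i j k hij hik hjk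
    have h2 := mul_le_mul_of_nonneg_right (hlt i hp.1 j hp.2.1 k hp.2.2 hij hik hjk)
      (by positivity : (0 : ℝ) ≤ s ^ 3)
    simp only [tri]
    linarith
  have hsum := hedges.trans (Finset.sum_le_sum htri)
  have hdiag : ∀ i ∈ I, ∑ j ∈ I, pen (i = j) = s ^ 3 := fun i hi => by
    rw [Finset.sum_eq_single_of_mem i hi fun j _ hj => if_neg hj.symm]
    exact if_pos rfl
  have hpen1 : ∑ p ∈ I ×ˢ I ×ˢ I, pen (p.1 = p.2.1) = M ^ 2 * s ^ 3 := by
    simp only [Finset.sum_product, Finset.sum_const, nsmul_eq_mul, hIM, ← Finset.mul_sum]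
    rw [Finset.sum_congr rfl hdiag, Finset.sum_const, hIM, nsmul_eq_mul]
    ring
  have hpen2 : ∑ p ∈ I ×ˢ I ×ˢ I, pen (p.1 = p.2.2) = M ^ 2 * s ^ 3 := by
    simp only [Finset.sum_product, Finset.sum_const, nsmul_eq_mul, hIM, ← Finset.mul_sum]
    rw [Finset.sum_congr rfl hdiag, Finset.sum_const, hIM, nsmul_eq_mul]
    ring
  have hpen3 : ∑ p ∈ I ×ˢ I ×ˢ I, pen (p.2.1 = p.2.2) = M ^ 2 * s ^ 3 := by
    simp only [Finset.sum_product]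
    rw [Finset.sum_const, Finset.sum_congr rfl hdiag, Finset.sum_const, hIM, nsmul_eq_mul,
      nsmul_eq_mul]
    ring
  rw [Finset.sum_add_distrib, Finset.sum_add_distrib, Finset.sum_add_distrib, hpen1, hpen2,
    hpen3, Finset.sum_const, nsmul_eq_mul, Finset.card_product, Finset.card_product, hIM] at hsum
  push_cast at hsum
  have hlow := hH U
  rw [hUcard] at hlow
  have hch := cube_div_le_choose_three (le_trans h3 (Nat.le_mul_of_pos_right M hs))
  push_cast at hch
  have hM0 : (0 : ℝ) < M := by
    have : 0 < M := by omega
    exact_mod_cast this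
  have hpos : 0 < (M * s : ℝ) ^ 3 := by positivity
  have h5 : 3 * ((M : ℝ) ^ 2 * s ^ 3) ≤ d / 108 * (M * s) ^ 3 := by
    have := mul_le_mul_of_nonneg_right hM (by positivity : (0 : ℝ) ≤ (M : ℝ) ^ 2 * s ^ 3)
    rw [mul_pow]
    nlinarith
  have h6 : d * ((M * s : ℝ) ^ 3 / 27) ≤ d * ((M * s).choose 3 : ℝ) :=
    mul_le_mul_of_nonneg_left hch hd.le
  have h7 : 0 < d * (M * s : ℝ) ^ 3 := by positivity
  have h8 : (M : ℝ) * (M * M) * (d / 108 * s ^ 3) = d / 108 * (M * s) ^ 3 := by ring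
  have h9 : d * ((M * s : ℝ) ^ 3 / 27) = 4 * (d / 108 * (M * s) ^ 3) := by ring
  linarith

end LocalDensity

section RamseyChain
open scoped Classical

/-- In a lower regular system all of whose long lists of clusters contain a dense triple, every
sufficiently long list of clusters contains a list whose two halves form a good pair. -/
theorem exists_goodPair_sublist (m M : ℕ) (hm : 1 ≤ m) {d : ℝ} (hd : 0 < d) (hd1 : d ≤ 1) :
    ∃ N₂ : ℕ, ∀ Q : ℕ, ∃ c : ℝ, 0 < c ∧ ∃ γ₀ : ℝ, 0 < γ₀ ∧ ∃ r₀ : ℕ, ∀ r γ, r₀ ≤ r → γ ≤ γ₀ →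
      ∀ {ι V : Type} [Fintype ι], Fintype.card ι = Q → ∀ (E : Finset (Finset V))
        (B : ι → Finset V) (s : ℕ), 0 < s → (∀ i, #(B i) = s) → LowerRegular E B r γ →
        ∀ A : List ι, A.Nodup → N₂ ≤ A.length →
        (∀ A' : List ι, A'.Sublist A → A'.length = M →
          ∃ i j k, [i, j, k].Sublist A' ∧ d ≤ boxDens E B {{i, j, k}}) →
        ∃ Y : List ι, Y.Sublist A ∧ Y.length = 2 * m ∧ GoodPair E B c (Y.take m) (Y.drop m) := by
  obtain ⟨R, hR⟩ := exists_nat_ge (2 * m / d)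
  rw [div_le_iff₀ hd, mul_comm (R : ℝ)] at hR
  set cb := d / 2 ^ (R + 1) with hcb
  have hcb0 : 0 < cb := by positivity
  have hcb1 : cb ≤ 1 := by
    rw [hcb, div_le_one (by positivity)]
    exact hd1.trans (one_le_pow₀ (by norm_num))
  have hm0 : (0 : ℝ) < m := by exact_mod_cast hm
  set ε := cb / (4 * m) with hε
  have hε0 : 0 < ε := by positivity
  obtain ⟨θ₀, hθ₀, N₀, hN₀⟩ := exists_label_dense m ε hε0
  set θ := min θ₀ 1 with hθ
  have hθ0 : 0 < θ := lt_min hθ₀ one_pos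
  set N := N₀ + 1 with hN
  obtain ⟨N₁, hN₁⟩ := ramsey_of_unavoidable (m + 2) (R + 2) (N + m)
  obtain ⟨N₂, hN₂⟩ := ramsey_of_unavoidable 3 M N₁
  refine ⟨N₂, fun Q => ?_⟩
  set g := cb / 4 with hg
  have hg0 : 0 < g := by positivity
  obtain ⟨r₀, hr₀⟩ := exists_nat_ge (2 * N / (g / 2) ^ N)
  set c₁ := (1 / 2 : ℝ) ^ N * ((g / 2) ^ N) ^ Q with hc₁
  have hc₁0 : 0 < c₁ := by positivity
  refine ⟨c₁ / 2 ^ N * θ ^ Q, by positivity, cb / 2, by positivity, r₀ + 1, ?_⟩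
  intro r γ hr hγ ι V _ hQ E B s hs hBs hreg A hA hlen hM
  have hB : ∀ i, 0 < #(B i) := fun i => by rw [hBs]; exact hs
  have hs0 : (0 : ℝ) < s := by exact_mod_cast hs
  have hr0 : 0 < r := by omega
  have hr0' : (0 : ℝ) < r := by exact_mod_cast hr0
  suffices hun : ∀ D : List ι, D.Sublist A → D.length = M → ∃ J : List ι, J.Sublist D ∧
      J.length = 3 ∧ ∀ i j k, J = [i, j, k] → d ≤ boxDens E B {{i, j, k}} by
    obtain ⟨A₁, hA₁, hA₁len, hdense⟩ :=
      hN₂ (fun J => ∀ i j k, J = [i, j, k] → d ≤ boxDens E B {{i, j, k}}) A hlen hun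
    have hdense' : ∀ i j k, [i, j, k].Sublist A₁ → d ≤ boxDens E B {{i, j, k}} :=
      fun i j k h => hdense _ h rfl i j k rfl
    suffices hun : ∀ D : List ι, D.Sublist A₁ → D.length = R + 2 → ∃ J : List ι, J.Sublist D ∧
        J.length = m + 2 ∧ ∀ i j K, J = i :: j :: K → cb ≤ boxDens E B (bookPattern i j K) by
      obtain ⟨A₂, hA₂, hA₂len, hbook⟩ := hN₁
        (fun J => ∀ i j K, J = i :: j :: K → cb ≤ boxDens E B (bookPattern i j K)) A₁
        hA₁len.ge hun
      have hA₂nd : A₂.Nodup := hA.sublist (hA₂.trans hA₁)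
      set I := A₂.take N with hI
      set Ks := A₂.drop N with hKs
      have hIKs : I ++ Ks = A₂ := List.take_append_drop N A₂
      have hIlen : I.length = N := by simp [hI, hA₂len]
      have hKslen : Ks.length = m := by simp [hKs, hA₂len]
      rw [← hIKs] at hA₂nd
      have hdis : ∀ w ∈ Ks, w ∉ I := fun w hw hwI =>
        (List.nodup_append.mp hA₂nd).2.2 w hwI w hw rfl
      have hGdense : ∀ i j, [i, j].Sublist I → ∀ D : ι → Finset V, (∀ i, D i ⊆ B i) →
          (∀ w ∈ Ks, D w = B w) → (∀ i, #(B i) ≤ r * #(D i)) → g * boxVol D ≤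
            #{x ∈ Fintype.piFinset D | PairDense E B ε Ks (x i) (x j)} := by
        intro i j hij D hDB hDK hside
        have hsub : (i :: j :: Ks).Sublist A₂ := by
          rw [← hIKs]
          exact hij.append (List.Sublist.refl Ks)
        have hiI : i ∈ I := hij.subset (by simp)
        have hjI : j ∈ I := hij.subset (by simp)
        have := hreg.card_pairDense hB hcb0.le (by omega : 1 ≤ Ks.length) hγ
          (fun h => hdis i h hiI) (fun h => hdis j h hjI)
          (hbook _ hsub (by simp [hKslen]) i j Ks rfl) hDB hDK hside
        rw [hKslen] at this
        exact this
      have hclique := card_clique hs hr0 (by omega : 1 ≤ N) hBs hg0 (by linarith : g ≤ 1) I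
        (List.nodup_append.mp hA₂nd).1 hdis hIlen.le hGdense s hs0 (by
          rw [hIlen, div_le_iff₀ hr0']
          have h1 : (r₀ : ℝ) ≤ r := by exact_mod_cast (by omega : r₀ ≤ r)
          have h2 := hr₀.trans h1
          rw [div_le_iff₀ (by positivity)] at h2
          nlinarith) B (fun _ => Subset.rfl) (fun _ _ => rfl) (fun i => by rw [hBs])
      have hvol : boxVol B = (s : ℝ) ^ Q := by
        simp [boxVol, hBs, hQ]
      rw [hIlen, hQ, mul_pow, ← mul_assoc, ← hc₁, ← hvol] at hclique
      obtain ⟨J, hJI, hJlen, hJ⟩ := exists_goodPair (m := m) hs hBs hθ0 (min_le_right _ _) hc₁0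
        hdis hIlen (fun R' hR' => by
          obtain ⟨J, h1, h2, h3⟩ := hN₀ B R' I Ks hKslen (by omega) hR'
          refine ⟨J, h1, h2, fun w hw lab => le_trans ?_ (h3 w hw lab)⟩
          exact mul_le_mul_of_nonneg_right (min_le_left _ _) (by positivity)) hclique
      rw [hQ] at hJ
      refine ⟨J ++ Ks, ?_, ?_, ?_⟩
      · refine List.Sublist.trans ?_ (hA₂.trans hA₁)
        rw [← hIKs]
        exact hJI.append (List.Sublist.refl Ks)
      · rw [List.length_append, hJlen, hKslen]
        omega
      · rw [List.take_left' hJlen, List.drop_left' hJlen]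
        exact hJ
    intro D hD hDlen
    match D, hDlen with
    | i :: j :: K₀, hDlen =>
      have hK₀ : K₀.length = R := by simpa using hDlen
      obtain ⟨K, hK, hKlen, hKd⟩ := exists_book hB hd hm i j K₀ (by rw [hK₀]; exact hR)
        (fun k hk => hdense' i j k
          (((List.singleton_sublist.mpr hk).cons_cons j).cons_cons i |>.trans hD))
      refine ⟨i :: j :: K, (hK.cons_cons j).cons_cons i, by simp [hKlen], ?_⟩
      rintro i' j' K' ⟨⟩
      rw [hK₀] at hKd
      exact hKd
  intro D hD hDlen
  obtain ⟨i, j, k, h1, h2⟩ := hM D hD hDlen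
  refine ⟨[i, j, k], h1, rfl, ?_⟩
  rintro i' j' k' ⟨⟩
  exact h2

end RamseyChain

section Placement
open scoped Classical

theorem List.Nodup.not_pair_sublist_swap {ι : Type} {l : List ι} (hl : l.Nodup) {x y : ι}
    (h₁ : [x, y].Sublist l) (h₂ : [y, x].Sublist l) : False := by
  induction l with
  | nil => simp at h₁
  | cons a l ih =>
    rw [List.nodup_cons] at hl
    rcases List.sublist_cons_iff.mp h₁ with h₁ | ⟨r, hr, h₁⟩
    · have hy : y ∈ l := h₁.subset (by simp)
      rcases List.sublist_cons_iff.mp h₂ with h₂ | ⟨r, hr, h₂⟩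
      · exact ih hl.2 h₁ h₂
      · exact hl.1 ((List.cons.inj hr).1 ▸ hy)
    · obtain ⟨rfl, rfl⟩ := List.cons.inj hr
      have hy : y ∈ l := h₁.subset (by simp)
      rcases List.sublist_cons_iff.mp h₂ with h₂ | ⟨r, hr, h₂⟩
      · exact hl.1 (h₂.subset (by simp))
      · exact hl.1 ((List.cons.inj hr).1 ▸ hy)

theorem GoodPair.sublist {ι V : Type} [Fintype ι] {E : Finset (Finset V)} {B : ι → Finset V}
    {c : ℝ} {J Ks X Ws : List ι} (h : GoodPair E B c J Ks) (hJK : (J ++ Ks).Nodup)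
    (hX : X.Sublist J) (hW : Ws.Sublist Ks) : GoodPair E B c X Ws := by
  intro T hT hmono
  have hJ := (List.nodup_append.mp hJK).1
  have hdis : ∀ x ∈ J, ∀ w ∈ Ks, x ≠ w := (List.nodup_append.mp hJK).2.2
  have hrestrict : ∀ x y w, [x, y].Sublist J → w ∈ Ks → {x, y, w} ∈ T →
      [x, y].Sublist X ∧ w ∈ Ws := by
    intro x y w hxy hw hxyw
    obtain ⟨a, b, v, hab, hv, heq⟩ := hT _ hxyw
    have hx : x ∈ J := hxy.subset (by simp)
    have hy : y ∈ J := hxy.subset (by simp)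
    have ha : a ∈ J := (hab.trans hX).subset (by simp)
    have hb : b ∈ J := (hab.trans hX).subset (by simp)
    have hxy' : x ≠ y := by
      rintro rfl
      exact hJ.not_pair_sublist_swap hxy hxy
    have hwmem : w ∈ ({a, b, v} : Finset ι) := heq ▸ by simp
    have hxmem : x ∈ ({a, b, v} : Finset ι) := heq ▸ by simp
    have hymem : y ∈ ({a, b, v} : Finset ι) := heq ▸ by simp
    simp only [Finset.mem_insert, Finset.mem_singleton] at hwmem hxmem hymem
    have hwv : w = v := by
      rcases hwmem with h | h | h
      · exact absurd h.symm (hdis a ha w hw)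
      · exact absurd h.symm (hdis b hb w hw)
      · exact h
    have hxv : x ≠ v := hdis x hx v (hW.subset hv)
    have hyv : y ≠ v := hdis y hy v (hW.subset hv)
    refine ⟨?_, hwv ▸ hv⟩
    rcases hxmem with rfl | rfl | h
    · rcases hymem with h | rfl | h
      · exact absurd h.symm hxy'
      · exact hab
      · exact absurd h hyv
    · rcases hymem with rfl | h | h
      · exact (hJ.not_pair_sublist_swap hxy (hab.trans hX)).elim
      · exact absurd h.symm hxy'
      · exact absurd h hyv
    · exact absurd h hxv
  refine h T (fun e he => ?_) fun w hw x y z hxy hyz hxyw hyzw => ?_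
  · obtain ⟨x, y, w, hxy, hw, rfl⟩ := hT e he
    exact ⟨x, y, w, hxy.trans hX, hW.subset hw, rfl⟩
  · obtain ⟨h1, h2⟩ := hrestrict x y w hxy hw hxyw
    exact hmono w h2 x y z h1 (hrestrict y z w hyz hw hyzw).1 hxyw hyzw

/-- If all `2 * m`-sublists of a list of length `3 * m` split into good pairs, then so do all
sublists of its middle third. -/
theorem goodPair_of_middle {ι V : Type} [Fintype ι] {E : Finset (Finset V)} {B : ι → Finset V}
    {c : ℝ} {m : ℕ} {A : List ι} (hA : A.Nodup) (hlen : A.length = 3 * m)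
    (hgood : ∀ Y : List ι, Y.Sublist A → Y.length = 2 * m → GoodPair E B c (Y.take m) (Y.drop m))
    {X Ws : List ι} (hXW : (X ++ Ws).Sublist ((A.drop m).take m)) : GoodPair E B c X Ws := by
  have hlenXW : X.length + Ws.length ≤ m := by
    have := hXW.length_le
    simp only [List.length_append, List.length_take, List.length_drop] at this
    omega
  set pre := (A.take m).take (m - X.length) with hpre
  set post := ((A.drop m).drop m).take (m - Ws.length) with hpost
  have hJlen : (pre ++ X).length = m := by
    simp only [hpre, List.length_append, List.length_take]
    omega
  have hKlen : (Ws ++ post).length = m := by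
    simp only [hpost, List.length_append, List.length_take, List.length_drop]
    omega
  have hsub : ((pre ++ X) ++ (Ws ++ post)).Sublist A := by
    have h1 : A = A.take m ++ ((A.drop m).take m ++ (A.drop m).drop m) := by
      rw [List.take_append_drop, List.take_append_drop]
    rw [h1, show (pre ++ X) ++ (Ws ++ post) = pre ++ ((X ++ Ws) ++ post) by simp]
    exact (List.take_sublist _ _).append (hXW.append (List.take_sublist _ _))
  have h := hgood _ hsub (by rw [List.length_append, hJlen, hKlen]; omega)
  rw [List.take_left' hJlen, List.drop_left' hJlen] at h
  exact h.sublist (hA.sublist hsub) (List.sublist_append_right _ _) (List.sublist_append_left _ _)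

theorem List.filter_append_filter_sublist {W : Type} {l : List W} {κ : W → ℕ} {p q : W → Prop}
    (hl : l.Pairwise fun x y => κ x < κ y) (hpq : ∀ x y, p x → q y → κ x < κ y) :
    ((l.filter fun x => p x) ++ (l.filter fun x => q x)).Sublist l := by
  induction l with
  | nil => simp
  | cons a l ih =>
    rw [List.pairwise_cons] at hl
    by_cases hq : q a
    · have hp : ∀ x ∈ a :: l, ¬ p x := by
        intro x hx hpx
        have h1 := hpq x a hpx hq
        rcases List.mem_cons.mp hx with rfl | hx
        · omega
        · have := hl.1 x hx
          omega
      rw [List.filter_eq_nil_iff.mpr (by simpa using hp), List.nil_append]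
      exact List.filter_sublist
    · by_cases hp : p a
      · simpa [hp, hq] using (ih hl.2).cons_cons a
      · simpa [hp, hq] using (ih hl.2).cons a

theorem List.pair_sublist_of_lt {W : Type} {l : List W} {κ : W → ℕ}
    (hl : l.Pairwise fun x y => κ x < κ y) {x y : W} (hx : x ∈ l) (hy : y ∈ l) (hxy : κ x < κ y) :
    [x, y].Sublist l := by
  induction l with
  | nil => simp at hx
  | cons a l ih =>
    rw [List.pairwise_cons] at hl
    rcases List.mem_cons.mp hx with rfl | hx'
    · rcases List.mem_cons.mp hy with rfl | hy
      · omega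
      · exact (List.singleton_sublist.mpr hy).cons_cons _
    · rcases List.mem_cons.mp hy with rfl | hy
      · have := hl.1 x hx'
        omega
      · exact (ih hl.2 hx' hy).cons a

theorem exists_sorted_list {W : Type} [Fintype W] {κ : W → ℕ} (hκ : Function.Injective κ) :
    ∃ l : List W, l.Pairwise (fun x y => κ x < κ y) ∧ (∀ x, x ∈ l) ∧
      l.length = Fintype.card W := by
  refine ⟨(univ : Finset W).toList.mergeSort (fun x y => decide (κ x ≤ κ y)), ?_, ?_, ?_⟩
  · have hnd : ((univ : Finset W).toList.mergeSort (fun x y => decide (κ x ≤ κ y))).Nodup :=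
      (List.mergeSort_perm _ _).nodup_iff.mpr (Finset.nodup_toList _)
    have hs := List.pairwise_mergeSort (le := fun x y : W => decide (κ x ≤ κ y))
      (fun a b c h1 h2 => by simp at *; omega) (fun a b => by simp; omega)
      (univ : Finset W).toList
    refine (hs.and hnd).imp fun {a b} h => ?_
    have h1 : κ a ≤ κ b := by simpa using h.1
    exact lt_of_le_of_ne h1 fun h2 => h.2 (hκ h2)
  · intro x
    exact (List.mergeSort_perm _ _).mem_iff.mpr (by simp)
  · rw [(List.mergeSort_perm _ _).length_eq]
    simp

theorem exists_map_eq {W ι : Type} {l : List W} (hl : l.Nodup) {l' : List ι}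
    (h : l.length = l'.length) (hmem : ∀ x, x ∈ l) : ∃ φ : W → ι, l.map φ = l' := by
  refine ⟨fun w => l'[l.idxOf w]'(h ▸ List.idxOf_lt_length_iff.mpr (hmem w)), ?_⟩
  apply List.ext_getElem
  · simpa using h
  · intro i h1 h2
    have h1' : i < l.length := by simpa using h1
    simp [hl.idxOf_getElem i h1']

theorem boxDens_empty {ι V : Type} [Fintype ι] (E : Finset (Finset V)) {B : ι → Finset V}
    (hB : ∀ i, 0 < #(B i)) : boxDens E B ∅ = 1 := by
  have hv := boxVol_pos hB
  rw [boxDens, div_eq_one_iff_eq hv.ne', ← card_piFinset_eq_boxVol]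
  simp [boxCount, Hits]

/-- Pieces that meet all earlier pieces in few points can be glued together. -/
theorem LowerRegular.glue_list {ι V τ : Type} [Fintype ι] {E : Finset (Finset V)}
    {B : ι → Finset V} {r : ℕ} {γ c : ℝ} (hreg : LowerRegular E B r γ) (hB : ∀ i, 0 < #(B i))
    (hr : 0 < r) (hγ : 0 ≤ γ) (hc : 0 ≤ c) (hc1 : c ≤ 1) (T : τ → Finset (Finset ι))
    (P : τ → Finset ι) (ts : List τ) (hT : ∀ t ∈ ts, ∀ e ∈ T t, e ⊆ P t)
    (hd : ∀ t ∈ ts, c ≤ boxDens E B (T t) - γ)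
    (hP : ts.Pairwise fun t t' => ∀ e ∈ T t', #(e ∩ P t) ≤ 1) :
    c ^ ts.length - ts.length / r ≤ boxDens E B (ts.toFinset.biUnion T) := by
  induction ts with
  | nil => simp [boxDens_empty E hB]
  | cons t ts ih =>
    rw [List.pairwise_cons] at hP
    have h1 := ih (fun t ht => hT t (by simp [ht])) (fun t ht => hd t (by simp [ht])) hP.2
    have h2 := hreg.glue hB hr hγ (ts.toFinset.biUnion T) (T t) (P t) (by
      intro e he
      obtain ⟨t', ht', he⟩ := Finset.mem_biUnion.mp he
      exact hP.1 t' (by simpa using ht') e he) (hT t (by simp)) c hc (hd t (by simp))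
    rw [List.toFinset_cons, Finset.biUnion_insert, Finset.union_comm]
    refine le_trans ?_ h2
    have h3 := mul_le_mul_of_nonneg_left h1 hc
    have h4 : (ts.length : ℝ) / r * c ≤ ts.length / r :=
      mul_le_of_le_one_right (by positivity) hc1
    rw [List.length_cons, pow_succ]
    push_cast
    rw [add_div]
    nlinarith

/-- A family of pieces, each good in the given order, embeds along the middle of a list all of
whose sublists of the right length split into good pairs. -/
theorem exists_hits_of_pieces {ι V W τ : Type} [Fintype ι] [Fintype W] {E : Finset (Finset V)}
    {B : ι → Finset V} {r m : ℕ} {γ c : ℝ} (hreg : LowerRegular E B r γ) (hB : ∀ i, 0 < #(B i))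
    (hr : 0 < r) (hγ : 0 ≤ γ) (hc : 0 < c) (hc1 : c ≤ 1) {A : List ι} (hA : A.Nodup)
    (hlen : A.length = 3 * m)
    (hgood : ∀ Y : List ι, Y.Sublist A → Y.length = 2 * m →
      GoodPair E B (c + γ) (Y.take m) (Y.drop m))
    (hWm : Fintype.card W ≤ m) {κ : W → ℕ} (hκ : Function.Injective κ) (ts : List τ)
    (Ep : τ → Finset (Finset W)) (X Y : τ → W → Prop)
    (h1 : ∀ t ∈ ts, ∀ e ∈ Ep t, ∃ x y w, κ x < κ y ∧ X t x ∧ X t y ∧ Y t w ∧ e = {x, y, w})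
    (h2 : ∀ t ∈ ts, ∀ x w, X t x → Y t w → κ x < κ w)
    (h3 : ∀ t ∈ ts, ∀ x y z w, X t x → X t y → X t z → Y t w → κ x < κ y → κ y < κ z →
      {x, y, w} ∈ Ep t → {y, z, w} ∈ Ep t → False)
    (h4 : ts.Pairwise fun t t' => ∀ e ∈ Ep t', #{v ∈ e | X t v ∨ Y t v} ≤ 1)
    (hpr : (ts.length : ℝ) / r < c ^ ts.length) :
    ∃ φ : W → ι, Function.Injective φ ∧ ∃ x : ι → V, (∀ i, x i ∈ B i) ∧
      ∀ t ∈ ts, ∀ e ∈ Ep t, e.image (x ∘ φ) ∈ E := by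
  obtain ⟨L, hL, hLmem, hLlen⟩ := exists_sorted_list hκ
  have hLnd : L.Nodup := hL.imp fun {a b} h => fun hab => by rw [hab] at h; omega
  set mid := ((A.drop m).take m).take (Fintype.card W) with hmid
  have hmidlen : L.length = mid.length := by
    simp only [hmid, hLlen, List.length_take, List.length_drop]
    omega
  obtain ⟨φ, hφ⟩ := exists_map_eq hLnd hmidlen hLmem
  have hmidnd : mid.Nodup := hA.sublist (((List.take_sublist _ _).trans
    (List.take_sublist _ _)).trans (List.drop_sublist _ _))
  have hφinj : Function.Injective φ := fun a b hab =>
    List.inj_on_of_nodup_map (hφ ▸ hmidnd) (hLmem a) (hLmem b) hab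
  refine ⟨φ, hφinj, ?_⟩
  have himginj : Function.Injective (Finset.image φ) := Finset.image_injective hφinj
  set T : τ → Finset (Finset ι) := fun t => (Ep t).image (Finset.image φ) with hTdef
  set P : τ → Finset ι := fun t => ({v | X t v ∨ Y t v} : Finset W).image φ with hPdef
  have hgp : ∀ t ∈ ts, GoodPair E B (c + γ) ((L.filter fun x => X t x).map φ)
      ((L.filter fun x => Y t x).map φ) := by
    intro t ht
    apply goodPair_of_middle hA hlen hgood
    rw [← List.map_append]
    refine ((List.filter_append_filter_sublist hL (h2 t ht)).map φ).trans ?_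
    rw [hφ]
    exact List.take_sublist _ _
  have hXsub : ∀ t x y, [x, y].Sublist ((L.filter fun x => X t x).map φ) →
      ∃ a b, x = φ a ∧ y = φ b ∧ X t a ∧ X t b ∧ κ a < κ b := by
    intro t x y hxy
    obtain ⟨l, hl, heq⟩ := List.sublist_map_iff.mp hxy
    match l, heq with
    | [a, b], heq =>
      simp only [List.map_cons, List.map_nil, List.cons.injEq, and_true] at heq
      have ha := List.mem_filter.mp (hl.subset (by simp : a ∈ [a, b]))
      have hb := List.mem_filter.mp (hl.subset (by simp : b ∈ [a, b]))
      exact ⟨a, b, heq.1, heq.2, by simpa using ha.2, by simpa using hb.2,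
        List.pairwise_iff_forall_sublist.mp hL (hl.trans List.filter_sublist)⟩
  have hTmem : ∀ t a b w, ({φ a, φ b, φ w} : Finset ι) ∈ T t → {a, b, w} ∈ Ep t := by
    intro t a b w h
    obtain ⟨e, he, heq⟩ := Finset.mem_image.mp h
    have : e = {a, b, w} := himginj (by rw [heq]; simp [Finset.image_insert])
    exact this ▸ he
  have hdens : ∀ t ∈ ts, c ≤ boxDens E B (T t) - γ := by
    intro t ht
    have := hgp t ht (T t) (fun e he => ?_) (fun w hw x y z hxy hyz hxyw hyzw => ?_)
    · linarith
    · obtain ⟨e', he', rfl⟩ := Finset.mem_image.mp he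
      obtain ⟨x, y, w, hxy, hx, hy, hw, rfl⟩ := h1 t ht e' he'
      refine ⟨φ x, φ y, φ w, ?_, ?_, by simp [Finset.image_insert]⟩
      · have : [x, y].Sublist (L.filter fun x => X t x) :=
          List.pair_sublist_of_lt (hL.sublist List.filter_sublist)
            (List.mem_filter.mpr ⟨hLmem x, by simpa using hx⟩)
            (List.mem_filter.mpr ⟨hLmem y, by simpa using hy⟩) hxy
        exact this.map φ
      · exact List.mem_map.mpr ⟨w, List.mem_filter.mpr ⟨hLmem w, by simpa using hw⟩, rfl⟩
    · obtain ⟨a, b, rfl, rfl, ha, hb, hab⟩ := hXsub t x y hxy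
      obtain ⟨b', e, hb', rfl, -, he, hbe⟩ := hXsub t (φ b) z hyz
      have := hφinj hb'
      subst this
      obtain ⟨v, hv, rfl⟩ := List.mem_map.mp hw
      have hv' : Y t v := by simpa using (List.mem_filter.mp hv).2
      exact h3 t ht a b e v ha hb he hv' hab hbe (hTmem t a b v hxyw) (hTmem t b e v hyzw)
  have hglue := hreg.glue_list hB hr hγ hc.le hc1 T P ts (by
    intro t ht e he
    obtain ⟨e', he', rfl⟩ := Finset.mem_image.mp he
    refine Finset.image_subset_image fun v hv => ?_
    obtain ⟨x, y, w, hxy, hx, hy, hw, rfl⟩ := h1 t ht e' he'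
    simp only [Finset.mem_insert, Finset.mem_singleton] at hv
    rcases hv with rfl | rfl | rfl <;> simp [*]) hdens (by
    refine h4.imp fun {t t'} h e he => ?_
    obtain ⟨e', he', rfl⟩ := Finset.mem_image.mp he
    rw [hPdef, ← Finset.image_inter _ _ hφinj, Finset.card_image_of_injective _ hφinj]
    refine le_trans (le_of_eq ?_) (h e' he')
    congr 1
    ext v
    simp)
  have hpos : 0 < boxDens E B (ts.toFinset.biUnion T) := by linarith
  have hcnt := boxDens_mul_boxVol E hB (ts.toFinset.biUnion T)
  have hcnt0 : (0 : ℝ) < boxCount E B (ts.toFinset.biUnion T) := by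
    rw [← hcnt]
    exact mul_pos hpos (boxVol_pos hB)
  have hcnt1 : 0 < boxCount E B (ts.toFinset.biUnion T) := by exact_mod_cast hcnt0
  obtain ⟨x, hx⟩ := Finset.card_pos.mp hcnt1
  rw [Finset.mem_filter, Fintype.mem_piFinset] at hx
  refine ⟨x, hx.1, fun t ht e he => ?_⟩
  rw [← Finset.image_image]
  exact hx.2 _ (Finset.mem_biUnion.mpr ⟨t, by simpa using ht, Finset.mem_image_of_mem _ he⟩)

end Placement

section Embedding
open scoped Classical

theorem GoodPair.mono {ι V : Type} [Fintype ι] {E : Finset (Finset V)} {B : ι → Finset V}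
    {c c' : ℝ} {J Ks : List ι} (h : GoodPair E B c J Ks) (hc : c' ≤ c) : GoodPair E B c' J Ks :=
  fun T hT hmono => hc.trans (h T hT hmono)

/-- A 3-graph that decomposes into pieces embeds into every uniformly dense 3-graph. -/
theorem exists_copy_of_pieces {W τ : Type} [Fintype W] {κ : W → ℕ} (hκ : Function.Injective κ)
    (ts : List τ) (Ep : τ → Finset (Finset W)) (X Y : τ → W → Prop)
    (h1 : ∀ t ∈ ts, ∀ e ∈ Ep t, ∃ x y w, κ x < κ y ∧ X t x ∧ X t y ∧ Y t w ∧ e = {x, y, w})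
    (h2 : ∀ t ∈ ts, ∀ x w, X t x → Y t w → κ x < κ w)
    (h3 : ∀ t ∈ ts, ∀ x y z w, X t x → X t y → X t z → Y t w → κ x < κ y → κ y < κ z →
      {x, y, w} ∈ Ep t → {y, z, w} ∈ Ep t → False)
    (h4 : ts.Pairwise fun t t' => ∀ e ∈ Ep t', #{v ∈ e | X t v ∨ Y t v} ≤ 1)
    {d : ℝ} (hd : 0 < d) (hd1 : d ≤ 1) :
    ∃ η : ℝ, 0 < η ∧ ∃ n₀ : ℕ, ∀ n, n₀ ≤ n → ∀ H : ThreeGraph (Fin n), UniformlyDense H d η →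
      ∃ φ : W → Fin n, Function.Injective φ ∧ ∀ t ∈ ts, ∀ e ∈ Ep t, e.image φ ∈ H.edges := by
  set m := Fintype.card W + 1 with hm
  obtain ⟨M₀, hM₀⟩ := exists_nat_ge (324 / d)
  set M := M₀ + 3 with hM
  have hMd : 324 ≤ d * M := by
    rw [div_le_iff₀ hd] at hM₀
    have : (M : ℝ) = M₀ + 3 := by rw [hM]; push_cast; ring
    rw [this]
    nlinarith
  obtain ⟨N₂, hN₂⟩ := exists_goodPair_sublist m M (by omega) (by positivity : 0 < d / 108)
    (by linarith)
  obtain ⟨Q, hQ⟩ := ramsey_of_unavoidable (2 * m) N₂ (3 * m)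
  obtain ⟨cg, hcg, γ₀, hγ₀, r₀, hr₀⟩ := hN₂ Q
  set c := min (cg / 2) 1 with hc
  have hc0 : 0 < c := lt_min (by positivity) one_pos
  set γ := min γ₀ (cg / 2) with hγ
  have hγ0 : 0 < γ := lt_min hγ₀ (by positivity)
  have hcγ : c + γ ≤ cg := by
    have h1 : c ≤ cg / 2 := min_le_left _ _
    have h2 : γ ≤ cg / 2 := min_le_right _ _
    linarith
  obtain ⟨r₁, hr₁⟩ := exists_nat_gt (ts.length / c ^ ts.length)
  set r := r₀ + r₁ + 2 with hr
  have hr0 : (0 : ℝ) < r := by rw [hr]; positivity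
  have hpr : (ts.length : ℝ) / r < c ^ ts.length := by
    rw [div_lt_iff₀ (by positivity)] at hr₁ ⊢
    have : (r₁ : ℝ) ≤ r := by exact_mod_cast (by omega : r₁ ≤ r)
    have h5 : 0 < c ^ ts.length := by positivity
    nlinarith
  obtain ⟨K, hK⟩ := exists_lowerRegular Q r (by omega) γ hγ0
  set D := Q * r ^ K + 1 with hD
  have hD0 : (0 : ℝ) < D := by rw [hD]; positivity
  refine ⟨d / 108 / (2 * D) ^ 3, by positivity, D, fun n hn H hH => ?_⟩
  set s₀ := n / D with hs₀
  have hs₀1 : 1 ≤ s₀ := (Nat.one_le_div_iff (by omega)).mpr hn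
  have hQn : Q * (s₀ * r ^ K) ≤ n := by
    have h1 : s₀ * D ≤ n := Nat.div_mul_le_self n D
    have h2 : s₀ * D = Q * (s₀ * r ^ K) + s₀ := by rw [hD]; ring
    omega
  have hnD : n ≤ 2 * D * s₀ := by
    have h1 : n < D * (s₀ + 1) := Nat.lt_mul_div_succ n (by omega)
    nlinarith
  obtain ⟨B, s, hdis, hBs, hs, hreg⟩ := hK n s₀ H.edges hs₀1 hQn
  have hspos : 0 < s := by omega
  have hB : ∀ i, 0 < #(B i) := fun i => by rw [hBs]; exact hspos
  have hη : d / 108 / (2 * D) ^ 3 * (n : ℝ) ^ 3 ≤ d / 108 * (M * s) ^ 3 := by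
    have h1 : (n : ℝ) ≤ 2 * D * s₀ := by exact_mod_cast hnD
    have h2 : (s₀ : ℝ) ≤ M * s := by
      have : s₀ ≤ M * s := hs.trans (Nat.le_mul_of_pos_left s (by omega))
      exact_mod_cast this
    calc d / 108 / (2 * D) ^ 3 * (n : ℝ) ^ 3 ≤ d / 108 / (2 * D) ^ 3 * (2 * D * s₀) ^ 3 := by
          gcongr
      _ = d / 108 * (s₀ : ℝ) ^ 3 := by
          field_simp
      _ ≤ d / 108 * (M * s) ^ 3 := by gcongr
  have hun : ∀ A : List (Fin Q), A.Sublist (List.finRange Q) → A.length = N₂ →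
      ∃ J : List (Fin Q), J.Sublist A ∧ J.length = 2 * m ∧
        GoodPair H.edges B cg (J.take m) (J.drop m) := by
    intro A hA hAlen
    have hAnd := (List.nodup_finRange Q).sublist hA
    refine hr₀ r γ (by omega) (min_le_left _ _) (Fintype.card_fin Q) H.edges B s hspos hBs hreg A
      hAnd hAlen.ge fun A' hA' hlen' => ?_
    exact exists_dense_triple H.card_eq hd (fun U => by convert hH U) hdis hspos hBs
      (hAnd.sublist hA') (by omega) (by rw [hlen']; exact hMd) (by rw [hlen']; exact hη)
  obtain ⟨A, hA, hAlen, hgood⟩ := hQ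
    (fun J => GoodPair H.edges B cg (J.take m) (J.drop m)) (List.finRange Q) (by simp) hun
  obtain ⟨φ, hφ, x, hx, hhit⟩ := exists_hits_of_pieces hreg hB (by omega) hγ0.le hc0
    (min_le_right _ _) ((List.nodup_finRange Q).sublist hA) hAlen
    (fun Y h h' => (hgood Y h h').mono hcγ) (by omega) hκ ts Ep X Y h1 h2 h3 h4 hpr
  refine ⟨x ∘ φ, fun a b hab => ?_, fun t ht e he => by convert hhit t ht e he⟩
  by_contra hne
  exact Finset.disjoint_left.mp (hdis _ _ fun h => hne (hφ h)) (hx (φ a))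
    (by rw [show x (φ a) = x (φ b) from hab]; exact hx (φ b))

end Embedding

section Layered
open scoped Classical

theorem exists_list_by_key {τ : Type} (T : Finset τ) (key : τ → ℕ) :
    ∃ l : List τ, (∀ t, t ∈ l ↔ t ∈ T) ∧ l.Pairwise fun t t' => t ≠ t' ∧ key t' ≤ key t := by
  refine ⟨T.toList.mergeSort (fun t t' => decide (key t' ≤ key t)), fun t => ?_, ?_⟩
  · rw [(List.mergeSort_perm _ _).mem_iff, Finset.mem_toList]
  · have hnd : (T.toList.mergeSort (fun t t' => decide (key t' ≤ key t))).Nodup :=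
      (List.mergeSort_perm _ _).nodup_iff.mpr (Finset.nodup_toList _)
    have hs := List.pairwise_mergeSort (le := fun t t' : τ => decide (key t' ≤ key t))
      (fun a b c h1 h2 => by simp at *; omega) (fun a b => by simp; omega) T.toList
    exact (hnd.and hs).imp fun {a b} h => ⟨h.1, by simpa using h.2⟩

/-- A triple of type `(a, b, c)`: two lower vertices with values `a ≤ b` and a top vertex with
value `c > b`. -/
def HasType {W : Type} (f : W → ℕ) (e : Finset W) (t : ℕ × ℕ × ℕ) : Prop :=
  t.1 ≤ t.2.1 ∧ t.2.1 < t.2.2 ∧ ∃ x y w, x ≠ y ∧ x ≠ w ∧ y ≠ w ∧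
    f x = t.1 ∧ f y = t.2.1 ∧ f w = t.2.2 ∧ e = {x, y, w}

theorem map_val_triple {W : Type} [DecidableEq W] (f : W → ℕ) {x y w : W} (hxy : x ≠ y)
    (hxw : x ≠ w) (hyw : y ≠ w) : Multiset.map f ({x, y, w} : Finset W).val = {f x, f y, f w} := by
  rw [Finset.insert_val_of_notMem (by simp [hxy, hxw]),
    Finset.insert_val_of_notMem (by simp [hyw]), Finset.singleton_val]
  rfl

theorem HasType.map_val {W : Type} {f : W → ℕ} {e : Finset W} {t : ℕ × ℕ × ℕ}
    (h : HasType f e t) : Multiset.map f e.val = ↑[t.1, t.2.1, t.2.2] := by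
  obtain ⟨-, -, x, y, w, hxy, hxw, hyw, hx, hy, hw, rfl⟩ := h
  rw [map_val_triple f hxy hxw hyw, hx, hy, hw]
  rfl

theorem HasType.unique {W : Type} {f : W → ℕ} {e e' : Finset W} {t t' : ℕ × ℕ × ℕ}
    (h : HasType f e t) (h' : HasType f e' t')
    (heq : Multiset.map f e.val = Multiset.map f e'.val) : t = t' := by
  rw [h.map_val, h'.map_val, Multiset.coe_eq_coe] at heq
  have hsort : ∀ {e : Finset W} {t}, HasType f e t → [t.1, t.2.1, t.2.2].Pairwise (· ≤ ·) := by
    intro e t h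
    have h1 := h.1
    have h2 := h.2.1
    simp only [List.pairwise_cons, List.mem_cons, List.not_mem_nil, or_false]
    refine ⟨?_, ?_, by simp⟩
    · rintro _ (rfl | rfl) <;> omega
    · rintro _ rfl
      omega
  have := heq.eq_of_pairwise' (hsort h) (hsort h')
  simp only [List.cons.injEq, and_true] at this
  exact Prod.ext this.1 (Prod.ext this.2.1 this.2.2)

/-- A 3-graph with a layered function whose links have no monotone path inside a layer embeds
into every uniformly dense 3-graph. -/
theorem exists_copy_of_layered {W : Type} [Fintype W] [DecidableEq W] {E : Finset (Finset W)}
    {f κ : W → ℕ} (hκ : Function.Injective κ) (hfκ : ∀ u v, f u < f v → κ u < κ v)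
    (hcard : ∀ e ∈ E, #e = 3) (htop : ∀ e ∈ E, ∃ w ∈ e, ∀ u ∈ e, u ≠ w → f u < f w)
    (hthird : ∀ e₁ ∈ E, ∀ e₂ ∈ E, ∀ u v w u' v' w' : W,
      u ≠ v → u ≠ w → v ≠ w → u' ≠ v' → u' ≠ w' → v' ≠ w' →
      e₁ = {u, v, w} → e₂ = {u', v', w'} → f u = f u' → f v = f v' → f w = f w')
    (hmono : ∀ x y z w, f x = f y → f y = f z → f z < f w → κ x < κ y → κ y < κ z →
      {x, y, w} ∈ E → {y, z, w} ∈ E → False)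
    {d : ℝ} (hd : 0 < d) (hd1 : d ≤ 1) :
    ∃ η : ℝ, 0 < η ∧ ∃ n₀ : ℕ, ∀ n, n₀ ≤ n → ∀ H : ThreeGraph (Fin n), UniformlyDense H d η →
      ∃ φ : W → Fin n, Function.Injective φ ∧ ∀ e ∈ E, e.image φ ∈ H.edges := by
  obtain rfl : ‹DecidableEq W› = fun a b => Classical.propDecidable (a = b) :=
    Subsingleton.elim _ _
  have htype : ∀ e ∈ E, ∃ t, HasType f e t := by
    intro e he
    obtain ⟨w, hw, hlt⟩ := htop e he
    have h2 : #(e.erase w) = 2 := by rw [Finset.card_erase_of_mem hw, hcard e he]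
    obtain ⟨x, y, hxy, heq⟩ := Finset.card_eq_two.mp h2
    have hx : x ∈ e.erase w := by rw [heq]; simp
    have hy : y ∈ e.erase w := by rw [heq]; simp
    rw [Finset.mem_erase] at hx hy
    have hfx := hlt x hx.2 hx.1
    have hfy := hlt y hy.2 hy.1
    have he' : e = {x, y, w} := by
      rw [← Finset.insert_erase hw, heq]
      ext v
      simp only [Finset.mem_insert, Finset.mem_singleton]
      tauto
    rcases le_total (f x) (f y) with hle | hle
    · exact ⟨(f x, f y, f w), hle, hfy, x, y, w, hxy, hx.1, hy.1, rfl, rfl, rfl, he'⟩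
    · refine ⟨(f y, f x, f w), hle, hfx, y, x, w, hxy.symm, hy.1, hx.1, rfl, rfl, rfl, ?_⟩
      rw [he', Finset.insert_comm]
  choose! ty hty using htype
  obtain ⟨ts, hts, hpair⟩ := exists_list_by_key (E.image ty)
    (fun t => if t.1 = t.2.1 then 1 + t.2.2 else 0)
  set Ep : ℕ × ℕ × ℕ → Finset (Finset W) := fun t => {e ∈ E | ty e = t} with hEp
  have hEpt : ∀ t, ∀ e ∈ Ep t, e ∈ E ∧ HasType f e t := by
    intro t e he
    obtain ⟨h1, rfl⟩ := Finset.mem_filter.mp he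
    exact ⟨h1, hty e h1⟩
  have hreal : ∀ t ∈ ts, ∃ e ∈ E, HasType f e t := by
    intro t ht
    obtain ⟨e, he, rfl⟩ := Finset.mem_image.mp ((hts t).mp ht)
    exact ⟨e, he, hty e he⟩
  obtain ⟨η, hη, n₀, h⟩ := exists_copy_of_pieces hκ ts Ep
    (fun t v => f v = t.1 ∨ f v = t.2.1) (fun t v => f v = t.2.2)
    (fun t _ e he => by
      obtain ⟨-, -, -, x, y, w, hxy, -, -, hx, hy, hw, rfl⟩ := hEpt t e he
      rcases lt_or_gt_of_ne (fun h => hxy (hκ h)) with hlt | hlt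
      · exact ⟨x, y, w, hlt, Or.inl hx, Or.inr hy, hw, rfl⟩
      · exact ⟨y, x, w, hlt, Or.inr hy, Or.inl hx, hw, Finset.insert_comm _ _ _⟩)
    (fun t ht x w hx hw => by
      obtain ⟨e, -, hab, hbc, -⟩ := hreal t ht
      exact hfκ x w (by omega))
    (fun t ht x y z w hx hy hz hw hxy hyz hxyw hyzw => by
      have hmon : ∀ u v, κ u < κ v → f u ≤ f v := fun u v huv => by
        by_contra! hlt
        exact absurd (hfκ v u hlt) (by omega)
      obtain ⟨hE1, hab, hbc, x₁, y₁, w₁, -, -, -, hx₁, hy₁, -, heq₁⟩ := hEpt t _ hxyw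
      obtain ⟨hE2, -, -, x₂, y₂, w₂, -, -, -, hx₂, hy₂, -, heq₂⟩ := hEpt t _ hyzw
      have hm1 := hmon x y hxy
      have hm2 := hmon y z hyz
      have m1 : y₁ ∈ ({x, y, w} : Finset W) := by rw [heq₁]; simp
      have m2 : x₂ ∈ ({y, z, w} : Finset W) := by rw [heq₂]; simp
      simp only [Finset.mem_insert, Finset.mem_singleton] at m1 m2
      have hyb : f y = t.2.1 := by
        rcases m1 with rfl | rfl | rfl <;> omega
      have hya : f y = t.1 := by
        rcases m2 with rfl | rfl | rfl <;> omega
      exact hmono x y z w (by omega) (by omega) (by omega) hxy hyz hE1 hE2)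
    (hpair.imp_of_mem fun {t t'} ht ht' hne e he => by
      obtain ⟨he, hte⟩ := hEpt t' e he
      obtain ⟨e₀, he₀, hte₀⟩ := hreal t ht
      have hab := hte₀.1
      have hbc := hte₀.2.1
      obtain ⟨-, -, x, y, z, hxy, hxz, hyz, hx, hy, hz, heq₀⟩ := id hte₀
      refine Finset.card_le_one.mpr ?_
      intro u hu v hv
      replace hu := (@Finset.mem_filter _ _ (_) _ _).mp hu
      replace hv := (@Finset.mem_filter _ _ (_) _ _).mp hv
      by_contra huv
      obtain ⟨w, hw⟩ : ∃ w, w ∈ e \ {u, v} := by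
        rw [← Finset.Nonempty, ← Finset.card_pos]
        have h1 := Finset.le_card_sdiff {u, v} e
        have h2 : #({u, v} : Finset W) ≤ 2 := Finset.card_le_two
        have h3 := hcard e he
        omega
      simp only [Finset.mem_sdiff, Finset.mem_insert, Finset.mem_singleton, not_or] at hw
      have huw : u ≠ w := fun h => hw.2.1 h.symm
      have hvw : v ≠ w := fun h => hw.2.2 h.symm
      have heq : e = {u, v, w} := by
        refine (Finset.eq_of_subset_of_card_le (fun a ha => ?_) ?_).symm
        · simp only [Finset.mem_insert, Finset.mem_singleton] at ha
          rcases ha with rfl | rfl | rfl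
          · exact hu.1
          · exact hv.1
          · exact hw.1
        · rw [hcard e he, Finset.card_eq_three.mpr ⟨u, v, w, huv, huw, hvw, rfl⟩]
      have hclose : ∀ x y z, x ≠ y → x ≠ z → y ≠ z → e₀ = {x, y, z} → f u = f x → f v = f y →
          False := by
        intro x y z hxy hxz hyz heq₀ hux hvy
        have hwz := hthird e he e₀ he₀ u v w x y z huv huw hvw hxy hxz hyz heq heq₀ hux hvy
        refine hne.1 (hte₀.unique hte ?_)
        rw [heq, heq₀, map_val_triple f hxy hxz hyz, map_val_triple f huv huw hvw, hux, hvy, hwz]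
      have hxyz : e₀ = {x, z, y} := by rw [heq₀, Finset.pair_comm]
      have hyxz : e₀ = {y, x, z} := by rw [heq₀, Finset.insert_comm]
      have hyzx : e₀ = {y, z, x} := by rw [hyxz, Finset.pair_comm]
      have hzxy : e₀ = {z, x, y} := by rw [hxyz, Finset.insert_comm]
      have hzyx : e₀ = {z, y, x} := by rw [hzxy, Finset.pair_comm]
      by_cases hfuv : f u = f v
      · obtain ⟨ha'b', hb'c', x', y', z', -, -, -, hx', hy', hz', heq'⟩ := hte
        have hu' := hu.1
        have hv' := hv.1
        rw [heq'] at hu' hv'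
        simp only [Finset.mem_insert, Finset.mem_singleton] at hu' hv'
        have hl : t'.1 = f u ∧ t'.2.1 = f u := by
          rcases hu' with rfl | rfl | rfl <;> rcases hv' with rfl | rfl | rfl <;>
            first
            | exact absurd rfl huv
            | (constructor <;> omega)
        have hkey := hne.2
        rw [if_pos (by omega)] at hkey
        have ht12 : t.1 = t.2.1 := by
          by_contra h
          rw [if_neg h] at hkey
          omega
        rw [if_pos ht12] at hkey
        exact hclose x y z hxy hxz hyz heq₀ (by omega) (by omega)
      · rcases hu.2 with (h | h) | h <;> rcases hv.2 with (h' | h') | h'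
        · omega
        · exact hclose x y z hxy hxz hyz heq₀ (by omega) (by omega)
        · exact hclose x z y hxz hxy hyz.symm hxyz (by omega) (by omega)
        · exact hclose y x z hxy.symm hyz hxz hyxz (by omega) (by omega)
        · omega
        · exact hclose y z x hyz hxy.symm hxz.symm hyzx (by omega) (by omega)
        · exact hclose z x y hxz.symm hyz.symm hxy hzxy (by omega) (by omega)
        · exact hclose z y x hyz.symm hxz.symm hxy.symm hzyx (by omega) (by omega)
        · omega) hd hd1
  refine ⟨η, hη, n₀, fun n hn H hH => ?_⟩
  obtain ⟨φ, hφ, hφE⟩ := h n hn H hH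
  refine ⟨φ, hφ, fun e he => hφE (ty e) ?_ e ?_⟩
  · exact (hts _).mpr (Finset.mem_image_of_mem _ he)
  · exact Finset.mem_filter.mpr ⟨he, rfl⟩

end Layered

section Union
open scoped Classical

/-- The vertex of the common vertex set that a vertex of the layer union is a copy of. -/
def unionBase {A : Type} {f : A → ℕ} {S : Finset ℕ} {ℓ : ℕ} : LayerUnionVert A f S ℓ → A :=
  Sum.elim (fun v => v.1) (fun p => p.1.1)

/-- The index of the copy a vertex lies in, with `ℓ` for the identified vertices. -/
def unionIndex {A : Type} {f : A → ℕ} {S : Finset ℕ} {ℓ : ℕ} : LayerUnionVert A f S ℓ → ℕ :=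
  Sum.elim (fun _ => ℓ) (fun p => p.2)

lemma unionBase_map {A : Type} (f : A → ℕ) (S : Finset ℕ) {ℓ : ℕ} (i : Fin ℓ) (v : A) :
    unionBase (layerUnionMap f S i v) = v := by
  unfold layerUnionMap unionBase
  split_ifs <;> rfl

lemma unionIndex_lt {A : Type} {f : A → ℕ} {S : Finset ℕ} {ℓ : ℕ} (x : LayerUnionVert A f S ℓ) :
    unionIndex x < ℓ + 1 := by
  rcases x with x | ⟨x, i⟩
  · exact Nat.lt_succ_self ℓ
  · exact Nat.lt_succ_of_lt i.2

lemma unionIndex_map_eq {A : Type} (f : A → ℕ) (S : Finset ℕ) {ℓ : ℕ} (i : Fin ℓ) {u v : A}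
    (h : f u = f v) :
    unionIndex (layerUnionMap f S i u) = unionIndex (layerUnionMap f S i v) := by
  unfold layerUnionMap unionIndex
  simp only [h]
  split_ifs <;> rfl

lemma index_eq_of_layerUnionMap_eq {A : Type} {f : A → ℕ} {S : Finset ℕ} {ℓ : ℕ} {i j : Fin ℓ}
    {u v : A} (hu : f u ∉ S) (h : layerUnionMap f S i u = layerUnionMap f S j v) : i = j := by
  unfold layerUnionMap at h
  rw [dif_neg hu] at h
  split_ifs at h
  exact (Prod.mk.inj (Sum.inr.inj h)).2

lemma eq_of_unionBase_eq {A : Type} {f : A → ℕ} {S : Finset ℕ} {ℓ : ℕ}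
    {x y : LayerUnionVert A f S ℓ} (hb : unionBase x = unionBase y)
    (hi : unionIndex x = unionIndex y) : x = y := by
  rcases x with x | ⟨x, i⟩ <;> rcases y with y | ⟨y, j⟩
  · exact congrArg Sum.inl (Subtype.ext hb)
  · exact absurd hi (ne_of_gt j.2)
  · exact absurd hi (ne_of_lt i.2)
  · exact congrArg Sum.inr (Prod.ext (Subtype.ext hb) (Fin.ext hi))

lemma lex_lt {a a' b b' k : ℕ} (hb : b < k) (h : a < a') : a * k + b < a' * k + b' := by
  have := Nat.mul_le_mul_right k h
  rw [Nat.succ_mul] at this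
  omega

lemma lex_inj {a a' b b' k : ℕ} (hb : b < k) (hb' : b' < k) (h : a * k + b = a' * k + b') :
    a = a' ∧ b = b' := by
  rcases lt_trichotomy a a' with hlt | rfl | hlt
  · exact absurd h (lex_lt hb hlt).ne
  · exact ⟨rfl, by omega⟩
  · exact absurd h (lex_lt hb' hlt).ne'

/-- The order on the layer union: by layer, then by label, then by copy. -/
def unionRank {A : Type} {f : A → ℕ} {S : Finset ℕ} {ℓ : ℕ} (σ : A → ℕ) (N : ℕ)
    (x : LayerUnionVert A f S ℓ) : ℕ :=
  (f (unionBase x) * N + σ (unionBase x)) * (ℓ + 1) + unionIndex x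

lemma unionRank_injective {A : Type} {f : A → ℕ} {S : Finset ℕ} {ℓ : ℕ} {σ : A → ℕ} {N : ℕ}
    (hσ : Function.Injective σ) (hN : ∀ v, σ v < N) :
    Function.Injective (unionRank σ N : LayerUnionVert A f S ℓ → ℕ) := by
  intro x y h
  obtain ⟨h1, h2⟩ := lex_inj (unionIndex_lt x) (unionIndex_lt y) h
  obtain ⟨-, h3⟩ := lex_inj (hN _) (hN _) h1
  exact eq_of_unionBase_eq (hσ h3) h2

lemma unionRank_lt {A : Type} {f : A → ℕ} {S : Finset ℕ} {ℓ : ℕ} {σ : A → ℕ} {N : ℕ}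
    (hN : ∀ v, σ v < N) (x y : LayerUnionVert A f S ℓ)
    (h : f (unionBase x) < f (unionBase y)) : unionRank σ N x < unionRank σ N y :=
  lex_lt (unionIndex_lt x) (lex_lt (hN _) h)

lemma label_lt_of_unionRank_lt {A : Type} {f : A → ℕ} {S : Finset ℕ} {ℓ : ℕ} {σ : A → ℕ} {N : ℕ}
    (i : Fin ℓ) {u v : A} (hf : f u = f v)
    (h : unionRank σ N (layerUnionMap f S i u) < unionRank σ N (layerUnionMap f S i v)) :
    σ u < σ v := by
  unfold unionRank at h
  rw [unionBase_map, unionBase_map, unionIndex_map_eq f S i hf, hf] at h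
  have h' := lt_of_add_lt_add_right h
  have h'' := lt_of_mul_lt_mul_right h' (Nat.zero_le _)
  omega

lemma exists_triple_of_map_val {A : Type} [DecidableEq A] {f : A → ℕ} {e : Finset A} {a b c : ℕ}
    (h : Multiset.map f e.val = {a, b, c}) :
    ∃ u v w, u ≠ v ∧ u ≠ w ∧ v ≠ w ∧ e = {u, v, w} ∧ f u = a ∧ f v = b ∧ f w = c := by
  obtain ⟨u, hu, hfu, h⟩ := (Multiset.map_eq_cons f e.val _ a).mpr h
  obtain ⟨v, hv, hfv, h⟩ := (Multiset.map_eq_cons f _ _ b).mpr h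
  obtain ⟨w, hw, hfw⟩ := Multiset.map_eq_singleton.mp h
  have he : e.val = {u, v, w} := by
    rw [← Multiset.cons_erase hu, ← Multiset.cons_erase hv, hw]
    rfl
  have hnd := e.nodup
  rw [he] at hnd
  simp only [Multiset.insert_eq_cons, Multiset.nodup_cons, Multiset.mem_cons,
    Multiset.mem_singleton, not_or] at hnd
  refine ⟨u, v, w, hnd.1.1, hnd.1.2, hnd.2.1, ?_, hfu, hfv, hfw⟩
  ext z
  rw [← Finset.mem_val, he]
  simp

lemma mem_layerUnion {A : Type} [DecidableEq A] {ℓ : ℕ} {F : Fin ℓ → ThreeGraph A} {f : A → ℕ}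
    {S : Finset ℕ} {e : Finset (LayerUnionVert A f S ℓ)} :
    e ∈ (layerUnion F f S).edges ↔
      ∃ i, ∃ e' ∈ (F i).edges, e'.image (layerUnionMap f S i) = e := by
  simp [layerUnion]

/-- A triple in the `i`-th copy is the image of the triple of base vertices. -/
lemma triple_of_image_eq {A : Type} [DecidableEq A] {ℓ : ℕ} {f : A → ℕ} {S : Finset ℕ}
    {i : Fin ℓ} {e : Finset A} {x y z : LayerUnionVert A f S ℓ}
    (h : e.image (layerUnionMap f S i) = {x, y, z}) :
    e = {unionBase x, unionBase y, unionBase z} ∧ layerUnionMap f S i (unionBase x) = x ∧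
      layerUnionMap f S i (unionBase y) = y ∧ layerUnionMap f S i (unionBase z) = z := by
  have key : ∀ t ∈ ({x, y, z} : Finset (LayerUnionVert A f S ℓ)),
      layerUnionMap f S i (unionBase t) = t := by
    intro t ht
    rw [← h] at ht
    obtain ⟨v, -, rfl⟩ := Finset.mem_image.mp ht
    rw [unionBase_map]
  have hx := key x (by simp)
  have hy := key y (by simp)
  have hz := key z (by simp)
  refine ⟨?_, hx, hy, hz⟩
  refine Finset.image_injective (layerUnionMap_injective f S i) ?_
  rw [h, Finset.image_insert, Finset.image_insert, Finset.image_singleton, hx, hy, hz]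

lemma piUnif_eq_zero_of_exists_copy {W : Type} (G : ThreeGraph W)
    (h : ∀ d : ℝ, 0 < d → d ≤ 1 → ∃ η : ℝ, 0 < η ∧ ∃ n₀ : ℕ, ∀ n, n₀ ≤ n →
      ∀ H : ThreeGraph (Fin n), UniformlyDense H d η → HasCopy H G) : piUnif G = 0 := by
  refine le_antisymm (Real.sSup_nonpos ?_) (Real.sSup_nonneg fun d hd => hd.1)
  rintro d ⟨-, hd1, hd⟩
  by_contra! hpos
  obtain ⟨η, hη, n₀, hc⟩ := h d hpos hd1
  obtain ⟨n, hn, H, hH, hdense⟩ := hd η hη n₀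
  exact hH (hc n hn H hdense)

end Union

/-- Let `F 0, …, F (ℓ-1)` be layered 3-graphs on the same vertex set with common layered
function `f` and the same reduced graph (i.e. the same set of multisets of `f`-values of
edges), all with vanishing uniform Turán density, sharing a common labeling `σ` of the
vertex set under which no link graph of any `F i` contains a monotone `P₃`. Then for any
set `S` of layers (given by their `f`-values) containing no linked pair, the `S`-union
has vanishing uniform Turán density. -/
theorem stmt12 {α : Type} [Fintype α] [DecidableEq α] {ℓ : ℕ}
    (F : Fin ℓ → ThreeGraph α) (f : α → ℕ)
    (hlay : ∀ i, IsLayeredFunction (F i).edges f)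
    (hred : ∀ i j : Fin ℓ, ∀ m : Multiset ℕ,
      (∃ e ∈ (F i).edges, Multiset.map f e.val = m) ↔
      (∃ e ∈ (F j).edges, Multiset.map f e.val = m))
    (hpi : ∀ i, piUnif (F i) = 0)
    (σ : α → ℕ) (hσ : IsLabeling Finset.univ σ)
    (hmono : ∀ i, ∀ v a b c : α, σ a < σ b → σ b < σ c →
      ({v, a, b} : Finset α) ∈ (F i).edges → ({v, b, c} : Finset α) ∈ (F i).edges → False)
    (S : Finset ℕ) (hS : S ⊆ Finset.univ.image f)
    (hnolink : ∀ a ∈ S, ∀ b ∈ S, ∀ i, ∀ e ∈ (F i).edges,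
      ¬ (e.image f ⊆ ({a, b} : Finset ℕ))) :
    piUnif (layerUnion F f S) = 0 := by
  have hσinj : Function.Injective σ := by
    have h := hσ.injOn
    rwa [Finset.coe_univ, Set.injOn_univ] at h
  have hσlt : ∀ v, σ v < Fintype.card α + 1 := fun v => by
    have h := Finset.mem_coe.mp (hσ.mapsTo (Finset.mem_coe.mpr (Finset.mem_univ v)))
    rw [Finset.mem_Icc, Finset.card_univ] at h
    omega
  refine piUnif_eq_zero_of_exists_copy _ fun d hd hd1 => ?_
  refine exists_copy_of_layered (E := (layerUnion F f S).edges) (f := fun x => f (unionBase x))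
    (κ := unionRank σ (Fintype.card α + 1)) (unionRank_injective hσinj hσlt)
    (unionRank_lt hσlt) (layerUnion F f S).card_eq ?_ ?_ ?_ hd hd1
  · intro e he
    obtain ⟨i, e, he', rfl⟩ := mem_layerUnion.mp he
    obtain ⟨w, hw, hwtop⟩ := (hlay i).1 e he'
    refine ⟨_, Finset.mem_image_of_mem _ hw, fun u hu huw => ?_⟩
    obtain ⟨u, hue, rfl⟩ := Finset.mem_image.mp hu
    simp only [unionBase_map]
    exact hwtop u hue fun h => huw (h ▸ rfl)
  · intro e₁ he₁ e₂ he₂ u v w u' v' w' huv huw hvw huv' huw' hvw' heq₁ heq₂ hu hv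
    subst heq₁ heq₂
    obtain ⟨i, e, he, heq⟩ := mem_layerUnion.mp he₁
    obtain ⟨j, e', he', heq'⟩ := mem_layerUnion.mp he₂
    obtain ⟨rfl, hmu, hmv, hmw⟩ := triple_of_image_eq heq
    obtain ⟨rfl, hmu', hmv', hmw'⟩ := triple_of_image_eq heq'
    have ne_base : ∀ {i : Fin ℓ} {x y : LayerUnionVert α f S ℓ},
        layerUnionMap f S i (unionBase x) = x → layerUnionMap f S i (unionBase y) = y → x ≠ y →
        unionBase x ≠ unionBase y := fun hx hy hne h => hne (by rw [← hx, ← hy, h])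
    obtain ⟨e'', he'', hmap⟩ := (hred j i _).mp ⟨_, he', rfl⟩
    rw [map_val_triple f (ne_base hmu' hmv' huv') (ne_base hmu' hmw' huw')
      (ne_base hmv' hmw' hvw')] at hmap
    obtain ⟨x, y, z, hxy, hxz, hyz, rfl, hx, hy, hz⟩ := exists_triple_of_map_val hmap
    have := (hlay i).2.2 _ he _ he'' _ _ _ x y z (ne_base hmu hmv huv) (ne_base hmu hmw huw)
      (ne_base hmv hmw hvw) hxy hxz hyz rfl rfl (hu.trans hx.symm) (hv.trans hy.symm)
    exact this.trans hz
  · intro x y z w hxy hyz hzw hκxy hκyz he₁ he₂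
    obtain ⟨i, e, he, heq⟩ := mem_layerUnion.mp he₁
    obtain ⟨j, e', he', heq'⟩ := mem_layerUnion.mp he₂
    obtain ⟨rfl, hx, hy, hw⟩ := triple_of_image_eq heq
    obtain ⟨rfl, hy', hz', hw'⟩ := triple_of_image_eq heq'
    obtain rfl : i = j := by
      by_cases hyS : f (unionBase y) ∈ S
      · by_cases hwS : f (unionBase w) ∈ S
        · refine absurd ?_ (hnolink _ hyS _ hwS i _ he)
          simp [Finset.image_insert, hxy]
        · exact index_eq_of_layerUnionMap_eq hwS (hw.trans hw'.symm)
      · exact index_eq_of_layerUnionMap_eq hyS (hy.trans hy'.symm)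
    rw [← hx, ← hy] at hκxy
    rw [← hy, ← hz'] at hκyz
    refine hmono i (unionBase w) _ _ _ (label_lt_of_unionRank_lt i hxy hκxy)
      (label_lt_of_unionRank_lt i hyz hκyz) ?_ ?_
    · rwa [Finset.insert_comm, Finset.pair_comm (unionBase w)]
    · rwa [Finset.insert_comm, Finset.pair_comm (unionBase w)]
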